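/- arXiv:math/0602015 — 8 statements merged into one kernel-verified Lean document; each statement's English description precedes it below -/
import Mathlib

section
/- Let V = {x ∈ 𝔽₂^8 : x₁ + ⋯ + x₈ = 0} / ⟨(1,1,1,1,1,1,1,1)⟩ and define q : V → 𝔽₂ by q([x]) = (wt(x)/2) mod 2, where wt(x) denotes the number of nonzero coordinates of a representative x (which is even). Then q is well defined (independent of the representative), and the quadratic space (V, q) over 𝔽₂ is isometric to (𝔽₂^6, q_K) where q_K(x₁, …, x₆) = x₁x₂ + x₃x₄ + x₅x₆. -/
open Finset

/-- The summation functional on `𝔽₂^8`. -/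
def sumF : (Fin 8 → ZMod 2) →ₗ[ZMod 2] ZMod 2 := ∑ i : Fin 8, LinearMap.proj i

/-- The subspace `{x ∈ 𝔽₂^8 : x₁ + ⋯ + x₈ = 0}`. -/
def V0 : Submodule (ZMod 2) (Fin 8 → ZMod 2) := LinearMap.ker sumF

lemma allones_mem : (fun _ => (1 : ZMod 2)) ∈ V0 := by
  rw [V0, LinearMap.mem_ker, sumF]
  simp [LinearMap.sum_apply]
  decide

/-- The quotient `V = {x : ∑ xᵢ = 0} / ⟨(1,…,1)⟩`. -/
abbrev Vq : Type :=
  V0 ⧸ Submodule.span (ZMod 2) ({⟨fun _ => 1, allones_mem⟩} : Set V0)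

/-- The weight (number of nonzero coordinates) of a vector in `𝔽₂^8`. -/
def wt (x : Fin 8 → ZMod 2) : ℕ := (univ.filter fun i => x i ≠ 0).card

lemma mem_V0_iff (x : Fin 8 → ZMod 2) : x ∈ V0 ↔ ∑ i, x i = 0 := by
  simp [V0, sumF]

/-- Coordinates on `𝔽₂^8` whose restriction to `V0` is given by pairing with a symplectic basis of
`Vq` consisting of classes of weight `4`. -/
def symplecticCoord : (Fin 8 → ZMod 2) →ₗ[ZMod 2] (Fin 6 → ZMod 2) :=
  Matrix.mulVecLin
    !![1, 1, 1, 0, 1, 0, 0, 0;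
       1, 1, 1, 1, 0, 0, 0, 0;
       1, 1, 0, 0, 0, 1, 0, 1;
       1, 1, 0, 0, 0, 1, 1, 0;
       1, 0, 0, 1, 1, 1, 0, 0;
       1, 0, 1, 0, 0, 0, 1, 1]

lemma symplecticCoord_apply (x : Fin 8 → ZMod 2) : symplecticCoord x =
    ![x 0 + x 1 + x 2 + x 4, x 0 + x 1 + x 2 + x 3, x 0 + x 1 + x 5 + x 7,
      x 0 + x 1 + x 5 + x 6, x 0 + x 3 + x 4 + x 5, x 0 + x 2 + x 6 + x 7] := by
  ext i
  fin_cases i <;> simp [symplecticCoord, Matrix.mulVec, dotProduct, Fin.sum_univ_succ] <;> ring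

lemma wt_of_sum_eq_zero : ∀ x : Fin 8 → ZMod 2, ∑ i, x i = 0 →
    2 ∣ wt x ∧ ((wt x / 2 : ℕ) : ZMod 2) =
      (x 0 + x 1 + x 2 + x 4) * (x 0 + x 1 + x 2 + x 3) +
      (x 0 + x 1 + x 5 + x 7) * (x 0 + x 1 + x 5 + x 6) +
      (x 0 + x 3 + x 4 + x 5) * (x 0 + x 2 + x 6 + x 7) := by
  unfold wt
  decide +kernel

lemma eq_zero_or_one_of_symplecticCoord_eq_zero (x : Fin 8 → ZMod 2) (hx : ∑ i, x i = 0)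
    (h : symplecticCoord x = 0) : x = 0 ∨ x = fun _ => 1 := by
  rw [symplecticCoord_apply] at h
  revert x
  decide +kernel

lemma exists_symplecticCoord_eq (y : Fin 6 → ZMod 2) :
    ∃ x : Fin 8 → ZMod 2, ∑ i, x i = 0 ∧ symplecticCoord x = y := by
  refine ⟨![y 0 + y 1 + y 2 + y 3 + y 4 + y 5, y 0 + y 1 + y 2 + y 3, y 0 + y 1 + y 4,
    y 0 + y 5, y 1 + y 5, y 2 + y 3 + y 5, y 2 + y 4, y 3 + y 4], ?_⟩
  rw [symplecticCoord_apply]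
  revert y
  decide +kernel

lemma ker_symplecticCoord_domRestrict :
    Submodule.span (ZMod 2) ({⟨fun _ => 1, allones_mem⟩} : Set V0) =
      LinearMap.ker (symplecticCoord.domRestrict V0) := by
  apply le_antisymm
  · rw [Submodule.span_singleton_le_iff_mem, LinearMap.mem_ker, LinearMap.domRestrict_apply,
      symplecticCoord_apply]
    decide
  · rintro ⟨x, hx⟩ h
    rcases eq_zero_or_one_of_symplecticCoord_eq_zero x ((mem_V0_iff x).1 hx) h with rfl | rfl
    · exact Submodule.zero_mem _
    · exact Submodule.mem_span_singleton_self _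

lemma symplecticCoord_domRestrict_surjective :
    Function.Surjective (symplecticCoord.domRestrict V0) := fun y => by
  obtain ⟨x, hx, rfl⟩ := exists_symplecticCoord_eq y
  exact ⟨⟨x, (mem_V0_iff x).2 hx⟩, rfl⟩

/-- The isomorphism `Vq ≃ 𝔽₂^6` induced by `symplecticCoord`. -/
noncomputable def symplecticEquiv : Vq ≃ₗ[ZMod 2] (Fin 6 → ZMod 2) :=
  (Submodule.quotEquivOfEq _ _ ker_symplecticCoord_domRestrict).trans
    ((symplecticCoord.domRestrict V0).quotKerEquivOfSurjective
      symplecticCoord_domRestrict_surjective)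

lemma symplecticEquiv_mk (x : V0) :
    symplecticEquiv (Submodule.Quotient.mk x) = symplecticCoord x := rfl

/-- the weight of any representative is even, `q([x]) = wt(x)/2 mod 2` is a
well-defined quadratic form on `V`, and `(V, q)` is isometric to `(𝔽₂^6, q_K)` with
`q_K(x) = x₁x₂ + x₃x₄ + x₅x₆`. -/
theorem nikulin_discriminant_quadratic_space :
    (∀ x : V0, 2 ∣ wt (x : Fin 8 → ZMod 2)) ∧
    ∃ q : Vq → ZMod 2,
      (∀ x : V0, q (Submodule.Quotient.mk x) = ((wt (x : Fin 8 → ZMod 2) / 2 : ℕ) : ZMod 2)) ∧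
      ∃ iso : Vq ≃ₗ[ZMod 2] (Fin 6 → ZMod 2),
        ∀ w : Vq, q w = iso w 0 * iso w 1 + iso w 2 * iso w 3 + iso w 4 * iso w 5 := by
  refine ⟨fun x => (wt_of_sum_eq_zero x ((mem_V0_iff _).1 x.2)).1,
    fun w => symplecticEquiv w 0 * symplecticEquiv w 1 + symplecticEquiv w 2 * symplecticEquiv w 3 +
      symplecticEquiv w 4 * symplecticEquiv w 5, fun x => ?_, symplecticEquiv, fun _ => rfl⟩
  beta_reduce
  rw [(wt_of_sum_eq_zero x ((mem_V0_iff _).1 x.2)).2, symplecticEquiv_mk, symplecticCoord_apply]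
  rfl
end

section
/- Inside (U(2)³ ⊕ N) ⊗ ℚ, let L₀ be the ℤ-submodule generated by U(2)³ ⊕ N together with the six vectors ½(e₁+N₁+N₂+N₃+N₈), ½(e₂+N₁+N₅+N₆+N₈), ½(e₃+N₂+N₆+N₇+N₈), ½(f₁+N₁+N₂+N₄+N₈), ½(f₂+N₁+N₅+N₇+N₈), ½(f₃+N₃+N₄+N₅+N₈). Then the ℚ-bilinear extension of the form of U(2)³ ⊕ N takes integer values on L₀, L₀ is an even unimodular lattice, U(2)³ ⊕ N has index 2^6 in L₀, and {0} ⊕ N is a primitive sublattice of L₀. -/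
open Finset

/-- The ambient space `U(2)³ ⊗ ℚ`. -/
abbrev Kv : Type := Fin 3 → Fin 2 → ℚ

/-- The ambient space `N ⊗ ℚ = ℚ^8` of the Nikulin lattice. -/
abbrev Qv : Type := Fin 8 → ℚ

/-- The ambient space `(U(2)³ ⊕ N) ⊗ ℚ`. -/
abbrev Vt : Type := Kv × Qv

/-- The bilinear form of `U(2)³`: on each copy the Gram matrix is `[[0,2],[2,0]]`. -/
def bK (x y : Kv) : ℚ := ∑ i : Fin 3, (2 * (x i 0 * y i 1) + 2 * (x i 1 * y i 0))

/-- The bilinear form `b(x, y) = -2 ∑ xᵢ yᵢ` of the Nikulin lattice. -/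
def bN (x y : Qv) : ℚ := -2 * ∑ i, x i * y i

/-- The orthogonal direct sum form on `(U(2)³ ⊕ N) ⊗ ℚ`. -/
def bV (x y : Vt) : ℚ := bK x.1 y.1 + bN x.2 y.2

/-- The lattice `U(2)³` (integral points), spanned by the standard basis vectors. -/
def Kmod : Submodule ℤ Kv :=
  Submodule.span ℤ (Set.range fun p : Fin 3 × Fin 2 => Pi.single p.1 (Pi.single p.2 (1 : ℚ)))

/-- The basis vectors `N₁, …, N₈`. -/
def Nvec (i : Fin 8) : Qv := Pi.single i (1 : ℚ)

/-- The vector `N̂ = (N₁ + ⋯ + N₈)/2`. -/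
def Nhat : Qv := fun _ => 1 / 2

/-- The Nikulin lattice `N`. -/
def Nik : Submodule ℤ Qv := Submodule.span ℤ (insert Nhat (Set.range Nvec))

/-- The lattice `U(2)³ ⊕ N` inside `(U(2)³ ⊕ N) ⊗ ℚ`. -/
def Mlat : Submodule ℤ Vt := Kmod.prod Nik

/-- The basis vector `eᵢ` of the `i`-th copy of `U(2)`. -/
def eKv (i : Fin 3) : Kv := Pi.single i (Pi.single (0 : Fin 2) (1 : ℚ))

/-- The basis vector `fᵢ` of the `i`-th copy of `U(2)`. -/
def fKv (i : Fin 3) : Kv := Pi.single i (Pi.single (1 : Fin 2) (1 : ℚ))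

/-- The six glue vectors (each divided by two). -/
def glue : Set Vt :=
  {((1 : ℚ) / 2) • ((eKv 0, Nvec 0 + Nvec 1 + Nvec 2 + Nvec 7) : Vt),
   ((1 : ℚ) / 2) • ((eKv 1, Nvec 0 + Nvec 4 + Nvec 5 + Nvec 7) : Vt),
   ((1 : ℚ) / 2) • ((eKv 2, Nvec 1 + Nvec 5 + Nvec 6 + Nvec 7) : Vt),
   ((1 : ℚ) / 2) • ((fKv 0, Nvec 0 + Nvec 1 + Nvec 3 + Nvec 7) : Vt),
   ((1 : ℚ) / 2) • ((fKv 1, Nvec 0 + Nvec 4 + Nvec 6 + Nvec 7) : Vt),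
   ((1 : ℚ) / 2) • ((fKv 2, Nvec 2 + Nvec 3 + Nvec 4 + Nvec 7) : Vt)}

/-- The overlattice `L₀` generated by `U(2)³ ⊕ N` and the six glue vectors. -/
def L0 : Submodule ℤ Vt := Mlat ⊔ Submodule.span ℤ glue

/-- The sublattice `{0} ⊕ N` of `L₀`. -/
def Nsub : Submodule ℤ Vt := (⊥ : Submodule ℤ Kv).prod Nik

/-- The coordinates of the integral combinations of the doubled `N`-components of the glue vectors;
`a` and `b` hold the coefficients of the glue vectors over the `eᵢ` and the `fᵢ`. -/
def glueCode (a b : Fin 3 → ℤ) : Fin 8 → ℤ :=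
  ![a 0 + a 1 + b 0 + b 1, a 0 + a 2 + b 0, a 0 + b 2, b 0 + b 2, a 1 + b 1 + b 2, a 1 + a 2,
    a 2 + b 1, a 0 + a 1 + a 2 + b 0 + b 1 + b 2]

theorem mem_Nik {y : Qv} : y ∈ Nik ↔ ∃ (t : ℤ) (z : Fin 8 → ℤ), ∀ j, y j = t / 2 + z j := by
  simp only [Nik, Submodule.mem_span_insert, Submodule.mem_span_range_iff_exists_fun]
  constructor
  · rintro ⟨t, _, ⟨z, rfl⟩, rfl⟩
    refine ⟨t, z, fun j => ?_⟩
    simp [Nhat, Nvec, Finset.sum_apply, Pi.single_apply, div_eq_mul_inv]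
  · rintro ⟨t, z, h⟩
    refine ⟨t, _, ⟨z, rfl⟩, ?_⟩
    ext j
    simp [h, Nhat, Nvec, Finset.sum_apply, Pi.single_apply, div_eq_mul_inv]

theorem mem_Kmod {x : Kv} : x ∈ Kmod ↔ ∃ a : Fin 3 → Fin 2 → ℤ, ∀ i j, x i j = a i j := by
  simp only [Kmod, Submodule.mem_span_range_iff_exists_fun]
  constructor
  · rintro ⟨c, rfl⟩
    refine ⟨fun i j => c (i, j), fun i j => ?_⟩
    fin_cases i <;> fin_cases j <;>
      simp [Fintype.sum_prod_type, Fin.sum_univ_succ, Pi.single_apply]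
  · rintro ⟨a, h⟩
    refine ⟨fun p => a p.1 p.2, ?_⟩
    ext i j
    fin_cases i <;> fin_cases j <;>
      simp [h, Fintype.sum_prod_type, Fin.sum_univ_succ, Pi.single_apply]

theorem mem_L0 {x : Vt} : x ∈ L0 ↔ ∃ (a b : Fin 3 → ℤ) (t : ℤ) (z : Fin 8 → ℤ),
    (∀ i, x.1 i 0 = a i / 2) ∧ (∀ i, x.1 i 1 = b i / 2) ∧
      ∀ j, x.2 j = t / 2 + z j + glueCode a b j / 2 := by
  simp only [L0, glue, Submodule.mem_sup, Submodule.mem_span_insert, Submodule.mem_span_singleton]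
  constructor
  · rintro ⟨m, ⟨hK, hN⟩, _, ⟨a₀, _, ⟨a₁, _, ⟨a₂, _, ⟨b₀, _, ⟨b₁, _, ⟨b₂, rfl⟩, rfl⟩, rfl⟩, rfl⟩,
      rfl⟩, rfl⟩, rfl⟩
    obtain ⟨k, hk⟩ := mem_Kmod.1 hK
    obtain ⟨t, z, hz⟩ := mem_Nik.1 hN
    refine ⟨fun i => 2 * k i 0 + ![a₀, a₁, a₂] i, fun i => 2 * k i 1 + ![b₀, b₁, b₂] i, t,
      fun j => z j - glueCode (k · 0) (k · 1) j, fun i => ?_, fun i => ?_, fun j => ?_⟩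
    · fin_cases i <;> simp [hk, eKv, fKv] <;> ring
    · fin_cases i <;> simp [hk, eKv, fKv] <;> ring
    · fin_cases j <;> simp [hz, Nvec, glueCode] <;> ring
  · rintro ⟨a, b, t, z, ha, hb, hz⟩
    refine ⟨(0, fun j => t / 2 + z j), ⟨zero_mem _, mem_Nik.2 ⟨t, z, fun _ => rfl⟩⟩, _,
      ⟨a 0, _, ⟨a 1, _, ⟨a 2, _, ⟨b 0, _, ⟨b 1, _, ⟨b 2, rfl⟩, rfl⟩, rfl⟩, rfl⟩, rfl⟩, rfl⟩, ?_⟩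
    ext i j
    · fin_cases i <;> fin_cases j <;> simp [ha, hb, eKv, fKv] <;> ring
    · fin_cases i <;> simp [hz, Nvec, glueCode] <;> ring

theorem Mlat_le_L0 : Mlat ≤ L0 := le_sup_left

theorem mem_Mlat_iff_of_mem_L0 {x : Vt} (hx : x ∈ L0) :
    x ∈ Mlat ↔ ∀ i j, ∃ k : ℤ, x.1 i j = k := by
  constructor
  · intro h i j
    obtain ⟨k, hk⟩ := mem_Kmod.1 h.1
    exact ⟨k i j, hk i j⟩
  · intro h
    choose k hk using h
    obtain ⟨a, b, t, z, ha, hb, hz⟩ := mem_L0.1 hx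
    have ha' : a = fun i => 2 * k i 0 := by
      ext i
      have := ha i
      rw [hk, eq_div_iff two_ne_zero] at this
      have : k i 0 * 2 = a i := by exact_mod_cast this
      lia
    have hb' : b = fun i => 2 * k i 1 := by
      ext i
      have := hb i
      rw [hk, eq_div_iff two_ne_zero] at this
      have : k i 1 * 2 = b i := by exact_mod_cast this
      lia
    refine ⟨mem_Kmod.2 ⟨k, hk⟩, mem_Nik.2
      ⟨t, fun j => z j + glueCode (k · 0) (k · 1) j, fun j => ?_⟩⟩
    subst ha' hb'
    fin_cases j <;> simp [hz, glueCode] <;> ring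

theorem bV_integral {x y : Vt} (hx : x ∈ L0) (hy : y ∈ L0) : ∃ k : ℤ, bV x y = k := by
  obtain ⟨a, b, t, z, ha, hb, hz⟩ := mem_L0.1 hx
  obtain ⟨a', b', t', z', ha', hb', hz'⟩ := mem_L0.1 hy
  have h : (2 : ℤ) ∣ ∑ i, (a i * b' i + b i * a' i) -
      ∑ j, (t + 2 * z j + glueCode a b j) * (t' + 2 * z' j + glueCode a' b' j) := by
    rw [← Nat.cast_two, ← ZMod.intCast_zmod_eq_zero_iff_dvd]
    simp only [Fin.sum_univ_succ, glueCode]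
    simp
    ring_nf
    reduce_mod_char
  obtain ⟨k, hk⟩ := h
  refine ⟨k, ?_⟩
  have hk' := congrArg (Int.cast : ℤ → ℚ) hk
  push_cast at hk'
  simp only [bV, bK, bN, ha, hb, hz, ha', hb', hz', Fin.sum_univ_succ, Fin.sum_univ_zero] at hk' ⊢
  linear_combination hk' / 2

theorem bV_even {x : Vt} (hx : x ∈ L0) : ∃ k : ℤ, bV x x = 2 * k := by
  obtain ⟨a, b, t, z, ha, hb, hz⟩ := mem_L0.1 hx
  have h : (4 : ℤ) ∣ 2 * ∑ i, a i * b i - ∑ j, (t + 2 * z j + glueCode a b j) ^ 2 := by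
    rw [← Nat.cast_ofNat, ← ZMod.intCast_zmod_eq_zero_iff_dvd]
    simp only [Fin.sum_univ_succ, glueCode]
    simp
    ring_nf
    reduce_mod_char
  obtain ⟨k, hk⟩ := h
  refine ⟨k, ?_⟩
  have hk' := congrArg (Int.cast : ℤ → ℚ) hk
  push_cast at hk'
  simp only [bV, bK, bN, ha, hb, hz, Fin.sum_univ_succ, Fin.sum_univ_zero] at hk' ⊢
  linear_combination hk' / 2

theorem mem_L0_of_dual {x : Vt} (h : ∀ m ∈ L0, ∃ k : ℤ, bV x m = k) : x ∈ L0 := by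
  have hK (k : Kv) (hk : k ∈ Kmod) : ∃ c : ℤ, bK x.1 k = c := by
    obtain ⟨c, hc⟩ := h (k, 0) (Mlat_le_L0 ⟨hk, zero_mem _⟩)
    exact ⟨c, by simpa [bV, bN] using hc⟩
  have hN (n : Qv) (hn : n ∈ Nik) : ∃ c : ℤ, bN x.2 n = c := by
    obtain ⟨c, hc⟩ := h (0, n) (Mlat_le_L0 ⟨zero_mem _, hn⟩)
    exact ⟨c, by simpa [bV, bK] using hc⟩
  have ha (i : Fin 3) : ∃ a : ℤ, x.1 i 0 = a / 2 := by
    obtain ⟨a, ha⟩ := hK _ (Submodule.subset_span ⟨(i, 1), rfl⟩)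
    refine ⟨a, ?_⟩
    rw [← ha]
    fin_cases i <;> simp [bK, Fin.sum_univ_succ, Pi.single_apply]
  have hb (i : Fin 3) : ∃ b : ℤ, x.1 i 1 = b / 2 := by
    obtain ⟨b, hb⟩ := hK _ (Submodule.subset_span ⟨(i, 0), rfl⟩)
    refine ⟨b, ?_⟩
    rw [← hb]
    fin_cases i <;> simp [bK, Fin.sum_univ_succ, Pi.single_apply]
  have hc (j : Fin 8) : ∃ c : ℤ, x.2 j = c / 2 := by
    obtain ⟨c, hc⟩ := hN (Nvec j) (Submodule.subset_span (Or.inr ⟨j, rfl⟩))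
    refine ⟨-c, ?_⟩
    push_cast
    rw [← hc]
    simp [bN, Nvec, Pi.single_apply]
  choose a ha using ha
  choose b hb using hb
  choose c hc using hc
  have hglue (p q : Fin 3 → ℤ) : ∃ k : ℤ,
      ∑ i, (a i * q i + b i * p i) - ∑ j, c j * glueCode p q j = 2 * k := by
    obtain ⟨k, hk⟩ := h (fun i => ![(p i : ℚ) / 2, q i / 2], fun j => glueCode p q j / 2)
      (mem_L0.2 ⟨p, q, 0, 0, by simp, by simp, by simp⟩)
    refine ⟨k, ?_⟩
    have : ∑ i, ((a i : ℚ) * q i + b i * p i) - ∑ j, (c j : ℚ) * glueCode p q j = 2 * k := by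
      rw [← hk]
      simp only [bV, bK, bN, ha, hb, hc, Fin.sum_univ_succ, Fin.sum_univ_zero]
      simp
      ring
    exact_mod_cast this
  obtain ⟨s, hs⟩ := hN Nhat (Submodule.subset_span (Or.inl rfl))
  have hs : -∑ j, c j = 2 * s := by
    have : -∑ j, (c j : ℚ) = 2 * s := by
      rw [← hs]
      simp only [bN, Nhat, hc, Fin.sum_univ_succ, Fin.sum_univ_zero]
      ring
    exact_mod_cast this
  obtain ⟨k₀, h₀⟩ := hglue (Pi.single 0 1) 0
  obtain ⟨k₁, h₁⟩ := hglue (Pi.single 1 1) 0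
  obtain ⟨k₂, h₂⟩ := hglue (Pi.single 2 1) 0
  obtain ⟨l₀, g₀⟩ := hglue 0 (Pi.single 0 1)
  obtain ⟨l₁, g₁⟩ := hglue 0 (Pi.single 1 1)
  obtain ⟨l₂, g₂⟩ := hglue 0 (Pi.single 2 1)
  simp [Fin.sum_univ_succ, glueCode] at h₀ h₁ h₂ g₀ g₁ g₂ hs
  have hz (j : Fin 8) : ∃ z : ℤ, c j = c 0 - glueCode a b 0 + 2 * z + glueCode a b j := by
    suffices (2 : ℤ) ∣ c j - (c 0 - glueCode a b 0 + glueCode a b j) by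
      obtain ⟨z, hz⟩ := this
      exact ⟨z, by lia⟩
    fin_cases j <;> simp [glueCode] <;> lia
  choose z hz using hz
  refine mem_L0.2 ⟨a, b, c 0 - glueCode a b 0, z, ha, hb, fun j => ?_⟩
  have := congrArg (Int.cast : ℤ → ℚ) (hz j)
  push_cast at this ⊢
  rw [hc]
  linear_combination this / 2

/-- The classes modulo `2` of the doubled `U(2)³`-coordinates of a vector of `L₀`. -/
def discHom : L0 →+ (Fin 3 → Fin 2 → ZMod 2) where
  toFun x i j := (⌊2 * x.1.1 i j⌋ : ℤ)
  map_zero' := by ext; simp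
  map_add' x y := by
    obtain ⟨a, b, -, -, ha, hb, -⟩ := mem_L0.1 x.2
    obtain ⟨a', b', -, -, ha', hb', -⟩ := mem_L0.1 y.2
    ext i j
    fin_cases j <;> simp [ha, hb, ha', hb', mul_add, mul_div_cancel₀]

theorem discHom_surjective : Function.Surjective discHom := by
  intro v
  refine ⟨⟨(fun i => ![((v i 0).val : ℚ) / 2, (v i 1).val / 2],
    fun j => glueCode (fun i => (v i 0).val) (fun i => (v i 1).val) j / 2),
    mem_L0.2 ⟨fun i => (v i 0).val, fun i => (v i 1).val, 0, 0, fun i => ?_, fun i => ?_, fun j => ?_⟩⟩, ?_⟩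
  rotate_left 3
  · ext i j
    fin_cases j <;> simp [discHom, mul_div_cancel₀, -ZMod.natCast_val, ZMod.natCast_zmod_val]
  all_goals simp

theorem ker_discHom : discHom.ker = (Mlat.comap L0.subtype).toAddSubgroup := by
  ext x
  obtain ⟨a, b, -, -, ha, hb, -⟩ := mem_L0.1 x.2
  rw [AddMonoidHom.mem_ker, Submodule.mem_toAddSubgroup, Submodule.mem_comap,
    Submodule.subtype_apply, mem_Mlat_iff_of_mem_L0 x.2, funext_iff]
  simp only [funext_iff]
  refine forall_congr' fun i => forall_congr' fun j => ?_
  obtain ⟨c, hc⟩ : ∃ c : ℤ, x.1.1 i j = c / 2 := by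
    fin_cases j
    exacts [⟨_, ha i⟩, ⟨_, hb i⟩]
  have : discHom x i j = (c : ZMod 2) := by simp [discHom, hc, mul_div_cancel₀]
  rw [this, hc, Pi.zero_apply, Pi.zero_apply, ZMod.intCast_zmod_eq_zero_iff_dvd]
  refine exists_congr fun k => ?_
  rw [div_eq_iff two_ne_zero, mul_comm (k : ℚ)]
  norm_cast

theorem card_L0_quotient_Mlat : Nat.card (L0 ⧸ Mlat.comap L0.subtype) = 2 ^ 6 := by
  have h : Nat.card (L0 ⧸ discHom.ker) = 2 ^ 6 := by
    rw [Nat.card_congr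
      (QuotientAddGroup.quotientKerEquivOfSurjective discHom discHom_surjective).toEquiv]
    simp
  rw [ker_discHom] at h
  exact h

theorem mem_Nsub_of_smul_mem {x : Vt} (hx : x ∈ L0) {n : ℤ} (hn : n ≠ 0) (h : n • x ∈ Nsub) :
    x ∈ Nsub := by
  have h0 : x.1 = 0 := by
    have : n • x.1 = 0 := h.1
    exact (smul_eq_zero.1 this).resolve_left hn
  refine ⟨h0, ((mem_Mlat_iff_of_mem_L0 hx).2 fun i j => ⟨0, by simp [h0]⟩).2⟩

/-- the form takes integer values on `L₀`; `L₀` is an even unimodular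
lattice; `U(2)³ ⊕ N` has index `2^6` in `L₀`; and `{0} ⊕ N` is primitive in `L₀`. -/
theorem overlattice_L0_properties :
    (∀ x ∈ L0, ∀ y ∈ L0, ∃ k : ℤ, bV x y = k) ∧
    (∀ x ∈ L0, ∃ k : ℤ, bV x x = 2 * k) ∧
    ({x : Vt | ∀ m ∈ L0, ∃ k : ℤ, bV x m = k} = (L0 : Set Vt)) ∧
    Mlat ≤ L0 ∧
    Nat.card (L0 ⧸ Mlat.comap L0.subtype) = 2 ^ 6 ∧
    (∀ x ∈ L0, ∀ n : ℤ, n ≠ 0 → n • x ∈ Nsub → x ∈ Nsub) := by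
  exact ⟨fun _ hx _ hy => bV_integral hx hy, fun _ hx => bV_even hx,
    Set.Subset.antisymm (fun _ h => mem_L0_of_dual h) fun _ hx _ hm => bV_integral hx hm,
    Mlat_le_L0, card_L0_quotient_Mlat, fun _ hx _ hn h => mem_Nsub_of_smul_mem hx hn h⟩
end

section
/- The lattice L₀ ⊂ (U(2)³ ⊕ N) ⊗ ℚ generated by U(2)³ ⊕ N together with the six vectors ½(e₁+N₁+N₂+N₃+N₈), ½(e₂+N₁+N₅+N₆+N₈), ½(e₃+N₂+N₆+N₇+N₈), ½(f₁+N₁+N₂+N₄+N₈), ½(f₂+N₁+N₅+N₇+N₈), ½(f₃+N₃+N₄+N₅+N₈) is isometric to U ⊕ U ⊕ U ⊕ E8(−1). -/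
open Matrix Finset
open Finset

/-- The hyperbolic plane `U`: bilinear form on `ℤ²` with Gram matrix `[[0,1],[1,0]]`. -/
def bU (x y : Fin 2 → ℤ) : ℤ := x 0 * y 1 + x 1 * y 0

/-- The bilinear form of `E8(-1)`: the negative of the E8 Cartan matrix pairing. -/
def bE8 (x y : Fin 8 → ℤ) : ℤ := -(x ⬝ᵥ (CartanMatrix.E₈ *ᵥ y))

/-- The underlying `ℤ`-module of `U ⊕ U ⊕ U ⊕ E8(-1)`. -/
abbrev UE8T : Type := (Fin 3 → Fin 2 → ℤ) × (Fin 8 → ℤ)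

/-- The bilinear form of `U ⊕ U ⊕ U ⊕ E8(-1)`. -/
def bUE8 (x y : UE8T) : ℤ := (∑ i : Fin 3, bU (x.1 i) (y.1 i)) + bE8 x.2 y.2

/-- The six glue vectors, indexed by the basis vectors of `U(2)³` whose halves they involve. -/
def glueVec : Fin 3 → Fin 2 → Vt :=
  ![![((1 / 2 : ℚ) • (eKv 0, Nvec 0 + Nvec 1 + Nvec 2 + Nvec 7)),
      ((1 / 2 : ℚ) • (fKv 0, Nvec 0 + Nvec 1 + Nvec 3 + Nvec 7))],
    ![((1 / 2 : ℚ) • (eKv 1, Nvec 0 + Nvec 4 + Nvec 5 + Nvec 7)),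
      ((1 / 2 : ℚ) • (fKv 1, Nvec 0 + Nvec 4 + Nvec 6 + Nvec 7))],
    ![((1 / 2 : ℚ) • (eKv 2, Nvec 1 + Nvec 5 + Nvec 6 + Nvec 7)),
      ((1 / 2 : ℚ) • (fKv 2, Nvec 2 + Nvec 3 + Nvec 4 + Nvec 7))]]

theorem glueVec_mem_L0 (i : Fin 3) (j : Fin 2) : glueVec i j ∈ L0 := by
  refine Submodule.mem_sup_right (Submodule.subset_span ?_)
  fin_cases i <;> fin_cases j
  · exact Or.inl rfl
  · exact Or.inr (Or.inr (Or.inr (Or.inl rfl)))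
  · exact Or.inr (Or.inl rfl)
  · exact Or.inr (Or.inr (Or.inr (Or.inr (Or.inl rfl))))
  · exact Or.inr (Or.inr (Or.inl rfl))
  · exact Or.inr (Or.inr (Or.inr (Or.inr (Or.inr rfl))))

/-- The integral combination of the generators of `L₀` with the given coefficients. -/
def genSum (k : Fin 3 → Fin 2 → ℤ) (n : Fin 8 → ℤ) (c : ℤ) (s : Fin 3 → Fin 2 → ℤ) : Vt :=
  (∑ i, ∑ j, k i j • ((Pi.single i (Pi.single j 1), 0) : Vt)) + (∑ l, n l • ((0, Nvec l) : Vt)) +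
    c • ((0, Nhat) : Vt) + ∑ i, ∑ j, s i j • glueVec i j

theorem genSum_mem_L0 (k : Fin 3 → Fin 2 → ℤ) (n : Fin 8 → ℤ) (c : ℤ) (s : Fin 3 → Fin 2 → ℤ) :
    genSum k n c s ∈ L0 := by
  refine add_mem (add_mem (add_mem ?_ ?_) ?_) ?_
  · refine sum_mem fun i _ => sum_mem fun j _ => L0.smul_mem _ (Submodule.mem_sup_left ?_)
    exact ⟨Submodule.subset_span ⟨(i, j), rfl⟩, zero_mem _⟩
  · refine sum_mem fun l _ => L0.smul_mem _ (Submodule.mem_sup_left ?_)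
    exact ⟨zero_mem _, Submodule.subset_span (Or.inr ⟨l, rfl⟩)⟩
  · refine L0.smul_mem _ (Submodule.mem_sup_left ?_)
    exact ⟨zero_mem _, Submodule.subset_span (Or.inl rfl)⟩
  · exact sum_mem fun i _ => sum_mem fun j _ => L0.smul_mem _ (glueVec_mem_L0 i j)

/-- Bases of three orthogonal hyperbolic planes in `L₀`. -/
def hypVec : Fin 3 → Fin 2 → Vt :=
  ![![(![![1, 0], ![0, 0], ![0, 0]], ![0, 0, 0, 0, 0, 0, 0, 0]),
      (![![1, 1/2], ![1, 0], ![1, 0]], ![1/2, 1/2, 0, 1/2, 0, 0, 0, 1/2])],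
    ![(![![0, 0], ![1, 0], ![0, 0]], ![0, 0, 0, 0, 0, 0, 0, 0]),
      (![![0, 0], ![1, 1/2], ![1, 0]], ![1/2, 0, 0, 0, 1/2, 0, 1/2, 1/2])],
    ![(![![0, 0], ![0, 0], ![1, 0]], ![0, 0, 0, 0, 0, 0, 0, 0]),
      (![![0, 0], ![0, 0], ![1, 1/2]], ![0, 0, 1/2, 1/2, 1/2, 0, 0, 1/2])]]

/-- Simple roots of the `E8(-1)` orthogonal to the planes spanned by `hypVec`. -/
def rootVec : Fin 8 → Vt :=
  ![(![![0, 0], ![-1/2, 0], ![-1, 0]], ![0, 1/2, -1/2, -1/2, 0, 0, -1/2, 0]),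
    (![![0, 0], ![1, 0], ![1, 0]], ![0, 0, 0, 0, 1, 0, 0, 0]),
    (![![0, 0], ![1, 0], ![0, 0]], ![0, 0, 0, 0, 0, 0, 1, 0]),
    (![![1/2, 0], ![-1, 0], ![0, 0]], ![0, 0, 0, 1/2, -1/2, -1/2, -1/2, 0]),
    (![![0, 0], ![0, 0], ![0, 0]], ![0, 0, 0, 0, 0, 1, 0, 0]),
    (![![-1, 0], ![-1/2, 0], ![-1/2, 0]], ![0, 0, 1/2, -1/2, 0, -1/2, 0, -1/2]),
    (![![1, 0], ![1, 0], ![1, 0]], ![0, 0, 0, 0, 0, 0, 0, 1]),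
    (![![-1/2, 0], ![0, 0], ![-1, 0]], ![1/2, -1/2, -1/2, 0, 0, 0, 0, -1/2])]

theorem hypVec_mem_L0 (i : Fin 3) (j : Fin 2) : hypVec i j ∈ L0 := by
  obtain ⟨k, n, c, s, h⟩ : ∃ k n c s, hypVec i j = genSum k n c s := by
    fin_cases i <;> fin_cases j
    · exact ⟨![![1, 0], ![0, 0], ![0, 0]], ![0, 0, 0, 0, 0, 0, 0, 0],
        0, ![![0, 0], ![0, 0], ![0, 0]], by decide +kernel⟩
    · exact ⟨![![1, 0], ![1, 0], ![1, 0]], ![0, 0, 0, 0, 0, 0, 0, 0],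
        0, ![![0, 1], ![0, 0], ![0, 0]], by decide +kernel⟩
    · exact ⟨![![0, 0], ![1, 0], ![0, 0]], ![0, 0, 0, 0, 0, 0, 0, 0],
        0, ![![0, 0], ![0, 0], ![0, 0]], by decide +kernel⟩
    · exact ⟨![![0, 0], ![1, 0], ![1, 0]], ![0, 0, 0, 0, 0, 0, 0, 0],
        0, ![![0, 0], ![0, 1], ![0, 0]], by decide +kernel⟩
    · exact ⟨![![0, 0], ![0, 0], ![1, 0]], ![0, 0, 0, 0, 0, 0, 0, 0],
        0, ![![0, 0], ![0, 0], ![0, 0]], by decide +kernel⟩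
    · exact ⟨![![0, 0], ![0, 0], ![1, 0]], ![0, 0, 0, 0, 0, 0, 0, 0],
        0, ![![0, 0], ![0, 0], ![0, 1]], by decide +kernel⟩
  exact h ▸ genSum_mem_L0 k n c s

theorem rootVec_mem_L0 (m : Fin 8) : rootVec m ∈ L0 := by
  obtain ⟨k, n, c, s, h⟩ : ∃ k n c s, rootVec m = genSum k n c s := by
    fin_cases m
    · exact ⟨![![0, 0], ![-1, 0], ![-1, 0]], ![-1, 0, -1, -1, -1, -1, -1, -1],
        1, ![![0, 0], ![1, 0], ![0, 0]], by decide +kernel⟩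
    · exact ⟨![![0, 0], ![1, 0], ![1, 0]], ![0, 0, 0, 0, 1, 0, 0, 0],
        0, ![![0, 0], ![0, 0], ![0, 0]], by decide +kernel⟩
    · exact ⟨![![0, 0], ![1, 0], ![0, 0]], ![0, 0, 0, 0, 0, 0, 1, 0],
        0, ![![0, 0], ![0, 0], ![0, 0]], by decide +kernel⟩
    · exact ⟨![![0, 0], ![-1, 0], ![0, 0]], ![-1, -1, -1, 0, -1, -1, -1, -1],
        1, ![![1, 0], ![0, 0], ![0, 0]], by decide +kernel⟩
    · exact ⟨![![0, 0], ![0, 0], ![0, 0]], ![0, 0, 0, 0, 0, 1, 0, 0],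
        0, ![![0, 0], ![0, 0], ![0, 0]], by decide +kernel⟩
    · exact ⟨![![-1, 0], ![-1, 0], ![-1, 0]], ![-1, -1, 0, -1, -1, -2, -1, -2],
        1, ![![0, 0], ![1, 0], ![1, 0]], by decide +kernel⟩
    · exact ⟨![![1, 0], ![1, 0], ![1, 0]], ![0, 0, 0, 0, 0, 0, 0, 1],
        0, ![![0, 0], ![0, 0], ![0, 0]], by decide +kernel⟩
    · exact ⟨![![-1, 0], ![0, 0], ![-1, 0]], ![0, -1, -1, 0, 0, 0, 0, -1],
        0, ![![1, 0], ![0, 0], ![0, 0]], by decide +kernel⟩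
  exact h ▸ genSum_mem_L0 k n c s

/-- The map `U ⊕ U ⊕ U ⊕ E8(-1) → L₀ ⊗ ℚ` sending the standard basis to `hypVec` and `rootVec`. -/
def toVt : UE8T →ₗ[ℤ] Vt where
  toFun x := (∑ i, ∑ j, x.1 i j • hypVec i j) + ∑ k, x.2 k • rootVec k
  map_add' x y := by
    simp only [Prod.fst_add, Prod.snd_add, Pi.add_apply, add_smul, sum_add_distrib]
    abel
  map_smul' c x := by
    simp only [Prod.smul_fst, Prod.smul_snd, Pi.smul_apply, smul_eq_mul, mul_smul, smul_add,
      smul_sum, RingHom.id_apply]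

theorem toVt_apply (x : UE8T) :
    toVt x = (∑ i, ∑ j, x.1 i j • hypVec i j) + ∑ k, x.2 k • rootVec k := rfl

theorem toVt_fst (x : UE8T) :
    (toVt x).1 =
      ![![(x.1 0 0 : ℚ) + x.1 0 1 + x.2 3 / 2 - x.2 5 + x.2 6 - x.2 7 / 2,
          (x.1 0 1 : ℚ) / 2],
        ![(x.1 0 1 : ℚ) + x.1 1 0 + x.1 1 1 - x.2 0 / 2 + x.2 1 + x.2 2 - x.2 3 - x.2 5 / 2 + x.2 6,
          (x.1 1 1 : ℚ) / 2],
        ![(x.1 0 1 : ℚ) + x.1 1 1 + x.1 2 0 + x.1 2 1 - x.2 0 + x.2 1 - x.2 5 / 2 + x.2 6 - x.2 7,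
          (x.1 2 1 : ℚ) / 2]] := by
  ext i j
  fin_cases i <;> fin_cases j <;>
    simp [toVt_apply, hypVec, rootVec, Fin.sum_univ_succ] <;> ring

theorem toVt_snd (x : UE8T) :
    (toVt x).2 =
      ![(x.1 0 1 : ℚ) / 2 + x.1 1 1 / 2 + x.2 7 / 2,
        (x.1 0 1 : ℚ) / 2 + x.2 0 / 2 - x.2 7 / 2,
        (x.1 2 1 : ℚ) / 2 - x.2 0 / 2 + x.2 5 / 2 - x.2 7 / 2,
        (x.1 0 1 : ℚ) / 2 + x.1 2 1 / 2 - x.2 0 / 2 + x.2 3 / 2 - x.2 5 / 2,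
        (x.1 1 1 : ℚ) / 2 + x.1 2 1 / 2 + x.2 1 - x.2 3 / 2,
        -(x.2 3 : ℚ) / 2 + x.2 4 - x.2 5 / 2,
        (x.1 1 1 : ℚ) / 2 - x.2 0 / 2 + x.2 2 - x.2 3 / 2,
        (x.1 0 1 : ℚ) / 2 + x.1 1 1 / 2 + x.1 2 1 / 2 - x.2 5 / 2 + x.2 6 - x.2 7 / 2] := by
  ext l
  fin_cases l <;> simp [toVt_apply, hypVec, rootVec, Fin.sum_univ_succ] <;> ring

theorem single_mem_range_toVt (i : Fin 3) (j : Fin 2) :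
    ((Pi.single i (Pi.single j 1), 0) : Vt) ∈ LinearMap.range toVt := by
  fin_cases i <;> fin_cases j
  · exact ⟨(![![1, 0], ![0, 0], ![0, 0]], ![0, 0, 0, 0, 0, 0, 0, 0]), by decide +kernel⟩
  · exact ⟨(![![2, 2], ![0, 0], ![0, 0]], ![-4, -6, -8, -12, -9, -6, -5, -2]), by decide +kernel⟩
  · exact ⟨(![![0, 0], ![1, 0], ![0, 0]], ![0, 0, 0, 0, 0, 0, 0, 0]), by decide +kernel⟩
  · exact ⟨(![![2, 0], ![2, 2], ![0, 0]], ![-2, -4, -5, -6, -5, -4, -4, -2]), by decide +kernel⟩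
  · exact ⟨(![![0, 0], ![0, 0], ![1, 0]], ![0, 0, 0, 0, 0, 0, 0, 0]), by decide +kernel⟩
  · exact ⟨(![![2, 0], ![2, 0], ![2, 2]], ![0, -3, -2, -4, -3, -2, -2, 0]), by decide +kernel⟩

theorem Nvec_mem_range_toVt (l : Fin 8) : ((0, Nvec l) : Vt) ∈ LinearMap.range toVt := by
  fin_cases l
  · exact ⟨(![![-1, 0], ![-1, 0], ![0, 0]], ![2, 3, 4, 6, 5, 4, 3, 2]), by decide +kernel⟩
  · exact ⟨(![![-1, 0], ![0, 0], ![0, 0]], ![2, 2, 3, 4, 3, 2, 1, 0]), by decide +kernel⟩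
  · exact ⟨(![![0, 0], ![0, 0], ![-1, 0]], ![0, 1, 1, 2, 2, 2, 1, 0]), by decide +kernel⟩
  · exact ⟨(![![-1, 0], ![0, 0], ![-1, 0]], ![0, 1, 1, 2, 1, 0, 0, 0]), by decide +kernel⟩
  · exact ⟨(![![0, 0], ![-1, 0], ![-1, 0]], ![0, 1, 0, 0, 0, 0, 0, 0]), by decide +kernel⟩
  · exact ⟨(![![0, 0], ![0, 0], ![0, 0]], ![0, 0, 0, 0, 1, 0, 0, 0]), by decide +kernel⟩
  · exact ⟨(![![0, 0], ![-1, 0], ![0, 0]], ![0, 0, 1, 0, 0, 0, 0, 0]), by decide +kernel⟩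
  · exact ⟨(![![-1, 0], ![-1, 0], ![-1, 0]], ![0, 0, 0, 0, 0, 0, 1, 0]), by decide +kernel⟩

theorem Nhat_mem_range_toVt : ((0, Nhat) : Vt) ∈ LinearMap.range toVt := by
  exact ⟨(![![-2, 0], ![-2, 0], ![-2, 0]], ![2, 4, 5, 7, 6, 4, 3, 1]), by decide +kernel⟩

theorem glueVec_mem_range_toVt (i : Fin 3) (j : Fin 2) : glueVec i j ∈ LinearMap.range toVt := by
  fin_cases i <;> fin_cases j
  · exact ⟨(![![-1, 0], ![-1, 0], ![-1, 0]], ![2, 3, 4, 6, 5, 4, 3, 1]), by decide +kernel⟩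
  · exact ⟨(![![-1, 1], ![-1, 0], ![-1, 0]], ![0, 0, 0, 0, 0, 0, 0, 0]), by decide +kernel⟩
  · exact ⟨(![![-1, 0], ![-1, 0], ![-1, 0]], ![1, 2, 2, 3, 3, 2, 2, 1]), by decide +kernel⟩
  · exact ⟨(![![0, 0], ![-1, 1], ![-1, 0]], ![0, 0, 0, 0, 0, 0, 0, 0]), by decide +kernel⟩
  · exact ⟨(![![-1, 0], ![-1, 0], ![0, 0]], ![1, 1, 2, 2, 2, 1, 1, 0]), by decide +kernel⟩
  · exact ⟨(![![0, 0], ![0, 0], ![-1, 1]], ![0, 0, 0, 0, 0, 0, 0, 0]), by decide +kernel⟩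

theorem range_toVt : LinearMap.range toVt = L0 := by
  apply le_antisymm
  · rintro _ ⟨x, rfl⟩
    exact add_mem
      (sum_mem fun i _ => sum_mem fun j _ => L0.smul_mem _ (hypVec_mem_L0 i j))
      (sum_mem fun k _ => L0.smul_mem _ (rootVec_mem_L0 k))
  · have hK : Kmod ≤ (LinearMap.range toVt).comap (LinearMap.inl ℤ Kv Qv) := by
      rw [Kmod, Submodule.span_le]
      rintro _ ⟨⟨i, j⟩, rfl⟩
      exact single_mem_range_toVt i j
    have hN : Nik ≤ (LinearMap.range toVt).comap (LinearMap.inr ℤ Kv Qv) := by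
      rw [Nik, Submodule.span_le]
      rintro _ (rfl | ⟨l, rfl⟩)
      · exact Nhat_mem_range_toVt
      · exact Nvec_mem_range_toVt l
    refine sup_le ?_ (Submodule.span_le.2 ?_)
    · rintro ⟨a, b⟩ ⟨ha, hb⟩
      have h := (LinearMap.range toVt).add_mem (hK ha) (hN hb)
      simpa using h
    · rintro _ (rfl | rfl | rfl | rfl | rfl | rfl)
      · exact glueVec_mem_range_toVt 0 0
      · exact glueVec_mem_range_toVt 1 0
      · exact glueVec_mem_range_toVt 2 0
      · exact glueVec_mem_range_toVt 0 1
      · exact glueVec_mem_range_toVt 1 1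
      · exact glueVec_mem_range_toVt 2 1

theorem bV_toVt (x y : UE8T) : bV (toVt x) (toVt y) = (bUE8 x y : ℚ) := by
  simp only [bV, bK, bN, toVt_fst, toVt_snd, bUE8, bU, bE8, CartanMatrix.E₈]
  simp [Fin.sum_univ_succ, dotProduct, Matrix.mulVec]
  ring

theorem toVt_injective : Function.Injective toVt := by
  rw [injective_iff_map_eq_zero]
  intro x hx
  have h1 := toVt_fst x
  have h2 := toVt_snd x
  rw [hx] at h1 h2
  have hK (i : Fin 3) (j : Fin 2) := congrFun (congrFun h1 i) j
  have hN (l : Fin 8) := congrFun h2 l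
  simp only [Fin.forall_fin_succ] at hK hN
  simp at hK hN
  obtain ⟨⟨a, a'⟩, ⟨b, b'⟩, c, c'⟩ := hK
  obtain ⟨h0, h1, h2, h3, h4, h5, h6, h7⟩ := hN
  refine Prod.ext (funext fun i => funext fun j => ?_) (funext fun k => ?_) <;>
    refine Int.cast_injective (α := ℚ) ?_
  · fin_cases i <;> fin_cases j <;> (simp; qify; linarith)
  · fin_cases k <;> (simp; qify; linarith)

/-- the lattice `L₀` generated by `U(2)³ ⊕ N` and the six glue vectors is
isometric to `U ⊕ U ⊕ U ⊕ E8(-1)`. -/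
theorem L0_isometric_U3E8 :
    ∃ e : UE8T ≃ₗ[ℤ] L0, ∀ x y : UE8T, bV (e x : Vt) (e y : Vt) = (bUE8 x y : ℚ) := by
  refine ⟨(LinearEquiv.ofInjective toVt toVt_injective).trans
    (LinearEquiv.ofEq _ _ range_toVt), fun x y => ?_⟩
  exact bV_toVt x y
end

section
/- Let j₀ : U(2)³ ⊕ N → U³ ⊕ E8(−1) be the isometric embedding obtained by composing the inclusion U(2)³ ⊕ N ⊆ L₀ with an isometry L₀ ≅ U³ ⊕ E8(−1), where L₀ is generated by U(2)³ ⊕ N and the six vectors ½(e₁+N₁+N₂+N₃+N₈), ½(e₂+N₁+N₅+N₆+N₈), ½(e₃+N₂+N₆+N₇+N₈), ½(f₁+N₁+N₂+N₄+N₈), ½(f₂+N₁+N₅+N₇+N₈), ½(f₃+N₃+N₄+N₅+N₈). Then for every isometric embedding j : U(2)³ ⊕ N → U³ ⊕ E8(−1) such that j({0} ⊕ N) is a primitive sublattice of U³ ⊕ E8(−1), there exist an isometry α of U(2)³ ⊕ N and an isometry β of U³ ⊕ E8(−1) with j ∘ α = β ∘ j₀. -/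
open Matrix Finset
open Finset

/-- The orthogonal sum of the hyperbolic plane and `Q`. -/
def hypSum {V : Type*} [AddCommGroup V] (Q : QuadraticForm ℤ V) :
    QuadraticForm ℤ ((ℤ × ℤ) × V) :=
  (QuadraticMap.linMulLin (LinearMap.fst ℤ ℤ ℤ) (LinearMap.snd ℤ ℤ ℤ)).prod Q

theorem hypSum_apply {V : Type*} [AddCommGroup V] (Q : QuadraticForm ℤ V) (a b : ℤ) (v : V) :
    hypSum Q ((a, b), v) = a * b + Q v := by
  simp [hypSum]

section Lifting

variable {V : Type*} [AddCommGroup V]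

/-- `ψ` is congruent modulo 2 to an isometry of `Q`. -/
def LiftsModTwo (Q : QuadraticForm ℤ V) (ψ : V →ₗ[ℤ] V) : Prop :=
  ∃ A : V ≃ₗ[ℤ] V, (∀ x, Q (A x) = Q x) ∧ ∀ x, ∃ y, A x = ψ x + (2 : ℤ) • y

/-- `ψ` preserves the reduction of `Q` modulo 2. -/
def IsometricModTwo (Q : QuadraticForm ℤ V) (ψ : V →ₗ[ℤ] V) : Prop :=
  ∀ x, Q (ψ x) ≡ Q x [ZMOD 2]

/-- The polar form of `Q` has odd determinant, in the sense that it is nondegenerate modulo 2. -/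
def NondegenerateModTwo (Q : QuadraticForm ℤ V) : Prop :=
  ∀ v, (∀ u, (2 : ℤ) ∣ QuadraticMap.polar Q v u) → ∃ y, v = (2 : ℤ) • y

theorem LiftsModTwo.of_comp {Q : QuadraticForm ℤ V} {ψ : V →ₗ[ℤ] V} (A : V ≃ₗ[ℤ] V)
    (hA : ∀ x, Q (A x) = Q x) (h : LiftsModTwo Q (A.toLinearMap ∘ₗ ψ)) : LiftsModTwo Q ψ := by
  obtain ⟨C, hC, hC'⟩ := h
  refine ⟨C.trans A.symm, fun x => ?_, fun x => ?_⟩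
  · rw [← hA]; simp [hC]
  · obtain ⟨y, hy⟩ := hC' x
    refine ⟨A.symm y, ?_⟩
    simp [hy]

theorem IsometricModTwo.comp {Q : QuadraticForm ℤ V} {ψ : V →ₗ[ℤ] V} (A : V ≃ₗ[ℤ] V)
    (hA : ∀ x, Q (A x) = Q x) (h : IsometricModTwo Q ψ) :
    IsometricModTwo Q (A.toLinearMap ∘ₗ ψ) := fun x => by
  simpa [hA] using h x

theorem polar_add_self (Q : QuadraticForm ℤ V) (x y : V) :
    Q (x + y) = Q x + Q y + QuadraticMap.polar Q x y := by
  simp [QuadraticMap.polar]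

theorem IsometricModTwo.polar {Q : QuadraticForm ℤ V} {ψ : V →ₗ[ℤ] V}
    (h : IsometricModTwo Q ψ) (x y : V) :
    QuadraticMap.polar Q (ψ x) (ψ y) ≡ QuadraticMap.polar Q x y [ZMOD 2] := by
  have := ((h (x + y)).sub (h x)).sub (h y)
  simpa [QuadraticMap.polar] using this

/-- The Eichler transvection attached to `u`. -/
def eichler (Q : QuadraticForm ℤ V) (u : V) : ((ℤ × ℤ) × V) →ₗ[ℤ] ((ℤ × ℤ) × V) where
  toFun x := ((x.1.1 - QuadraticMap.polar Q x.2 u - Q u * x.1.2, x.1.2), x.2 + x.1.2 • u)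
  map_add' x y := by
    ext
    · simp [QuadraticMap.polar_add_left]; ring
    · simp
    · simp [add_smul]; abel
  map_smul' c x := by
    ext
    · simp [QuadraticMap.polar_smul_left]; ring
    · simp
    · simp [mul_smul]

theorem eichler_apply (Q : QuadraticForm ℤ V) (u v : V) (a b : ℤ) :
    eichler Q u ((a, b), v) = ((a - QuadraticMap.polar Q v u - Q u * b, b), v + b • u) := rfl

theorem eichler_neg (Q : QuadraticForm ℤ V) (u : V) (x : (ℤ × ℤ) × V) :
    eichler Q (-u) (eichler Q u x) = x := by
  obtain ⟨⟨a, b⟩, v⟩ := x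
  simp [eichler_apply, QuadraticMap.polar_add_left, QuadraticMap.polar_smul_left,
    QuadraticMap.polar_neg_right]
  ring

/-- The Eichler transvection attached to `u`, as an automorphism. -/
def eichlerEquiv (Q : QuadraticForm ℤ V) (u : V) : ((ℤ × ℤ) × V) ≃ₗ[ℤ] ((ℤ × ℤ) × V) :=
  LinearEquiv.ofLinearMap (eichler Q u) (eichler Q (-u))
    (LinearMap.ext fun x => by simpa using eichler_neg Q (-u) x)
    (LinearMap.ext fun x => by simpa using eichler_neg Q u x)

theorem eichlerEquiv_apply (Q : QuadraticForm ℤ V) (u v : V) (a b : ℤ) :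
    eichlerEquiv Q u ((a, b), v) =
      ((a - QuadraticMap.polar Q v u - Q u * b, b), v + b • u) := rfl

theorem hypSum_eichlerEquiv (Q : QuadraticForm ℤ V) (u : V) (x : (ℤ × ℤ) × V) :
    hypSum Q (eichlerEquiv Q u x) = hypSum Q x := by
  obtain ⟨⟨a, b⟩, v⟩ := x
  rw [eichlerEquiv_apply, hypSum_apply, hypSum_apply, polar_add_self, QuadraticMap.map_smul,
    QuadraticMap.polar_smul_right]
  simp only [smul_eq_mul]
  ring

/-- The exchange of the two isotropic generators of the hyperbolic plane. -/
def hypSwap (V : Type*) [AddCommGroup V] : ((ℤ × ℤ) × V) ≃ₗ[ℤ] ((ℤ × ℤ) × V) :=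
  LinearEquiv.prodCongr (LinearEquiv.prodComm ℤ ℤ ℤ) (LinearEquiv.refl ℤ V)

theorem hypSwap_apply (v : V) (a b : ℤ) : hypSwap V ((a, b), v) = ((b, a), v) := rfl

theorem hypSum_hypSwap (Q : QuadraticForm ℤ V) (x : (ℤ × ℤ) × V) :
    hypSum Q (hypSwap V x) = hypSum Q x := by
  obtain ⟨⟨a, b⟩, v⟩ := x
  rw [hypSwap_apply, hypSum_apply, hypSum_apply, mul_comm]

theorem polar_hypSum (Q : QuadraticForm ℤ V) (a b c d : ℤ) (v w : V) :
    QuadraticMap.polar (hypSum Q) ((a, b), v) ((c, d), w) =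
      a * d + b * c + QuadraticMap.polar Q v w := by
  simp only [QuadraticMap.polar, Prod.mk_add_mk, hypSum_apply]
  ring

theorem polar_add_two_smul (Q : QuadraticForm ℤ V) (x y z : V) :
    QuadraticMap.polar Q x (y + (2 : ℤ) • z) ≡ QuadraticMap.polar Q x y [ZMOD 2] := by
  rw [QuadraticMap.polar_add_right, QuadraticMap.polar_smul_right]
  simp [Int.ModEq]

theorem eichlerEquiv_normalize (Q : QuadraticForm ℤ V) (a b : ℤ) (v : V) (hb : b ≡ 1 [ZMOD 2])
    (h : hypSum Q ((a, b), v) ≡ 0 [ZMOD 2]) :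
    ∃ y, eichlerEquiv Q (-v) ((a, b), v) = ((0, 1), 0) + (2 : ℤ) • y := by
  rw [hypSum_apply] at h
  obtain ⟨k, rfl⟩ : ∃ k, b = 1 + 2 * k := ⟨b / 2, by simp only [Int.ModEq] at hb; omega⟩
  obtain ⟨l, hl⟩ := Int.modEq_zero_iff_dvd.1 h
  refine ⟨((l - a * k - k * Q v, k), -(k • v)), ?_⟩
  rw [eichlerEquiv_apply]
  ext
  · simp
    linear_combination hl
  · simp
  · simp [add_smul, mul_smul]

theorem LiftsModTwo.hypSum_of_fix {Q : QuadraticForm ℤ V}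
    (hQ : ∀ φ, IsometricModTwo Q φ → LiftsModTwo Q φ)
    {ψ : ((ℤ × ℤ) × V) →ₗ[ℤ] ((ℤ × ℤ) × V)} (hψ : IsometricModTwo (hypSum Q) ψ)
    (he : ∃ y, ψ ((1, 0), 0) = ((1, 0), 0) + (2 : ℤ) • y)
    (hf : ∃ y, ψ ((0, 1), 0) = ((0, 1), 0) + (2 : ℤ) • y) : LiftsModTwo (hypSum Q) ψ := by
  obtain ⟨y, hy⟩ := he
  obtain ⟨z, hz⟩ := hf
  have h1 : ∀ v, (2 : ℤ) ∣ (ψ (0, v)).1.2 := fun v => by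
    have h := (polar_add_two_smul (hypSum Q) (ψ (0, v)) ((1, 0), 0) y).symm
    rw [← hy] at h
    have := h.trans (hψ.polar _ _)
    rw [← Int.modEq_zero_iff_dvd]
    generalize ψ (0, v) = w at this
    obtain ⟨⟨c, d⟩, w⟩ := w
    rw [polar_hypSum, show ((0 : ℤ × ℤ), v) = ((0, 0), v) from rfl, polar_hypSum] at this
    simpa using this
  have h2 : ∀ v, (2 : ℤ) ∣ (ψ (0, v)).1.1 := fun v => by
    have h := (polar_add_two_smul (hypSum Q) (ψ (0, v)) ((0, 1), 0) z).symm
    rw [← hz] at h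
    have := h.trans (hψ.polar _ _)
    rw [← Int.modEq_zero_iff_dvd]
    generalize ψ (0, v) = w at this
    obtain ⟨⟨c, d⟩, w⟩ := w
    rw [polar_hypSum, show ((0 : ℤ × ℤ), v) = ((0, 0), v) from rfl, polar_hypSum] at this
    simpa using this
  obtain ⟨A, hA, hA'⟩ := hQ (LinearMap.snd ℤ _ _ ∘ₗ ψ ∘ₗ LinearMap.inr ℤ _ _) fun v => by
    have h := hψ (0, v)
    have h1 := h1 v
    simp only [LinearMap.comp_apply, LinearMap.inr_apply, LinearMap.snd_apply]
    generalize ψ (0, v) = w at h h1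
    obtain ⟨⟨c, d⟩, w⟩ := w
    obtain ⟨k, rfl⟩ := h1
    rw [show ((0 : ℤ × ℤ), v) = ((0, 0), v) from rfl, hypSum_apply, hypSum_apply] at h
    simp only [Int.ModEq, mul_left_comm c 2 k] at h ⊢
    omega
  refine ⟨LinearEquiv.prodCongr (LinearEquiv.refl ℤ _) A, ?_, ?_⟩
  · rintro ⟨⟨a, b⟩, v⟩
    simp [hypSum_apply, hA]
  · rintro ⟨⟨a, b⟩, v⟩
    obtain ⟨t, ht⟩ := hA' v
    obtain ⟨c, hc⟩ := h2 v
    obtain ⟨d, hd⟩ := h1 v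
    have hx : (((a, b), v) : (ℤ × ℤ) × V) =
        a • ((1, 0), 0) + b • ((0, 1), 0) + (0, v) := by ext <;> simp
    have hw : ψ (0, v) = ((2 * c, 2 * d), (ψ (0, v)).2) := by rw [← hc, ← hd]
    refine ⟨-(a • y) - b • z + ((-c, -d), t), ?_⟩
    have hAv : (LinearEquiv.prodCongr (LinearEquiv.refl ℤ (ℤ × ℤ)) A) ((a, b), v) =
        ((a, b), (ψ (0, v)).2 + (2 : ℤ) • t) := by
      simp only [LinearEquiv.prodCongr_apply, LinearEquiv.refl_apply, ht]
      rfl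
    rw [hAv, hx, map_add, map_add, map_smul, map_smul, hy, hz, hw]
    ext
    · simp; ring
    · simp; ring
    · simp; module

theorem LiftsModTwo.hypSum_of_fix_right {Q : QuadraticForm ℤ V}
    (hQ : ∀ φ, IsometricModTwo Q φ → LiftsModTwo Q φ)
    {ψ : ((ℤ × ℤ) × V) →ₗ[ℤ] ((ℤ × ℤ) × V)} (hψ : IsometricModTwo (hypSum Q) ψ)
    (hf : ∃ y, ψ ((0, 1), 0) = ((0, 1), 0) + (2 : ℤ) • y) : LiftsModTwo (hypSum Q) ψ := by
  obtain ⟨y, hy⟩ := hf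
  obtain ⟨⟨⟨a, b⟩, u⟩, hx⟩ : ∃ x, ψ ((1, 0), 0) = x := ⟨_, rfl⟩
  have ha : a ≡ 1 [ZMOD 2] := by
    have h := (polar_add_two_smul (hypSum Q) (ψ ((1, 0), 0)) ((0, 1), 0) y).symm
    rw [← hy] at h
    simpa [hx, polar_hypSum] using h.trans (hψ.polar _ _)
  have hn : hypSum Q ((b, a), u) ≡ 0 [ZMOD 2] := by
    simpa [hx, hypSum_apply, mul_comm a b] using hψ ((1, 0), 0)
  obtain ⟨z, hz⟩ := eichlerEquiv_normalize Q b a u ha hn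
  let A := (hypSwap V).trans ((eichlerEquiv Q (-u)).trans (hypSwap V))
  have hA : ∀ x, hypSum Q (A x) = hypSum Q x := fun x => by
    simp only [A, LinearEquiv.trans_apply, hypSum_hypSwap, hypSum_eichlerEquiv]
  refine LiftsModTwo.of_comp A hA (LiftsModTwo.hypSum_of_fix hQ (hψ.comp A hA) ?_ ?_)
  · refine ⟨hypSwap V z, ?_⟩
    simp only [A, LinearMap.comp_apply, LinearEquiv.coe_coe, LinearEquiv.trans_apply, hx,
      hypSwap_apply, hz, map_add, map_smul]
  · refine ⟨A y, ?_⟩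
    have hf : A ((0, 1), 0) = ((0, 1), 0) := by
      simp [A, hypSwap_apply, eichlerEquiv_apply]
    rw [LinearMap.comp_apply, hy, LinearEquiv.coe_coe, map_add, map_smul, hf]

theorem LiftsModTwo.hypSum_of_odd {Q : QuadraticForm ℤ V}
    (hQ : ∀ φ, IsometricModTwo Q φ → LiftsModTwo Q φ)
    {ψ : ((ℤ × ℤ) × V) →ₗ[ℤ] ((ℤ × ℤ) × V)} (hψ : IsometricModTwo (hypSum Q) ψ)
    (hf : (ψ ((0, 1), 0)).1.2 ≡ 1 [ZMOD 2]) : LiftsModTwo (hypSum Q) ψ := by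
  obtain ⟨⟨⟨a, b⟩, u⟩, hx⟩ : ∃ x, ψ ((0, 1), 0) = x := ⟨_, rfl⟩
  rw [hx] at hf
  have hn : hypSum Q ((a, b), u) ≡ 0 [ZMOD 2] := by
    simpa [hx, hypSum_apply] using hψ ((0, 1), 0)
  obtain ⟨z, hz⟩ := eichlerEquiv_normalize Q a b u hf hn
  refine LiftsModTwo.of_comp _ (hypSum_eichlerEquiv Q (-u))
    (LiftsModTwo.hypSum_of_fix_right hQ (hψ.comp _ (hypSum_eichlerEquiv Q (-u))) ⟨z, ?_⟩)
  rw [LinearMap.comp_apply, hx, LinearEquiv.coe_coe, hz]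

theorem LiftsModTwo.hypSum_of_odd_left {Q : QuadraticForm ℤ V}
    (hQ : ∀ φ, IsometricModTwo Q φ → LiftsModTwo Q φ)
    {ψ : ((ℤ × ℤ) × V) →ₗ[ℤ] ((ℤ × ℤ) × V)} (hψ : IsometricModTwo (hypSum Q) ψ)
    (hf : (ψ ((0, 1), 0)).1.1 ≡ 1 [ZMOD 2]) : LiftsModTwo (hypSum Q) ψ :=
  LiftsModTwo.of_comp _ (hypSum_hypSwap Q)
    (LiftsModTwo.hypSum_of_odd hQ (hψ.comp _ (hypSum_hypSwap Q)) hf)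

/-- If isometries modulo 2 of `Q` lift, so do those of its sum with a hyperbolic plane. -/
theorem LiftsModTwo.hypSum_of_nondegenerate {Q : QuadraticForm ℤ V} (hnd : NondegenerateModTwo Q)
    (hQ : ∀ φ, IsometricModTwo Q φ → LiftsModTwo Q φ)
    {ψ : ((ℤ × ℤ) × V) →ₗ[ℤ] ((ℤ × ℤ) × V)} (hψ : IsometricModTwo (hypSum Q) ψ) :
    LiftsModTwo (hypSum Q) ψ := by
  obtain ⟨⟨⟨a, b⟩, v⟩, hx⟩ : ∃ x, ψ ((0, 1), 0) = x := ⟨_, rfl⟩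
  rcases Int.emod_two_eq_zero_or_one b with hb | hb
  swap
  · exact LiftsModTwo.hypSum_of_odd hQ hψ (by rw [hx]; exact hb)
  rcases Int.emod_two_eq_zero_or_one a with ha | ha
  swap
  · exact LiftsModTwo.hypSum_of_odd_left hQ hψ (by rw [hx]; exact ha)
  have hv : ∃ u, ¬ (2 : ℤ) ∣ QuadraticMap.polar Q v u := by
    by_contra! h
    obtain ⟨y, rfl⟩ := hnd v h
    have h1 := hψ.polar ((0, 1), 0) ((1, 0), 0)
    rw [hx, show ψ ((1, 0), 0) = (((ψ ((1, 0), 0)).1.1, (ψ ((1, 0), 0)).1.2),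
      (ψ ((1, 0), 0)).2) from rfl, polar_hypSum, polar_hypSum,
      QuadraticMap.polar_smul_left] at h1
    obtain ⟨k, rfl⟩ := Int.dvd_of_emod_eq_zero ha
    obtain ⟨l, rfl⟩ := Int.dvd_of_emod_eq_zero hb
    simp only [Int.ModEq, mul_assoc, smul_eq_mul, ← mul_add, QuadraticMap.polar_zero_left] at h1
    omega
  obtain ⟨u, hu⟩ := hv
  refine LiftsModTwo.of_comp _ (hypSum_eichlerEquiv Q u)
    (LiftsModTwo.hypSum_of_odd_left hQ (hψ.comp _ (hypSum_eichlerEquiv Q u)) ?_)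
  rw [LinearMap.comp_apply, hx, LinearEquiv.coe_coe, eichlerEquiv_apply]
  obtain ⟨l, rfl⟩ := Int.dvd_of_emod_eq_zero hb
  simp only [Int.ModEq, mul_left_comm _ (2 : ℤ)]
  omega

theorem NondegenerateModTwo.hypSum {Q : QuadraticForm ℤ V} (hnd : NondegenerateModTwo Q) :
    NondegenerateModTwo (hypSum Q) := by
  rintro ⟨⟨a, b⟩, v⟩ h
  obtain ⟨k, rfl⟩ : (2 : ℤ) ∣ a := by simpa [polar_hypSum] using h ((0, 1), 0)
  obtain ⟨l, rfl⟩ : (2 : ℤ) ∣ b := by simpa [polar_hypSum] using h ((1, 0), 0)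
  obtain ⟨y, rfl⟩ := hnd v fun u => by simpa [polar_hypSum] using h ((0, 0), u)
  exact ⟨((k, l), y), rfl⟩

end Lifting

/-- The orthogonal sum of three hyperbolic planes, as an iterated product. -/
abbrev U3T : Type := (ℤ × ℤ) × ((ℤ × ℤ) × ((ℤ × ℤ) × PUnit.{1}))

/-- The quadratic form `x ↦ b(x, x) / 2` of the sum of three hyperbolic planes. -/
abbrev qU3 : QuadraticForm ℤ U3T := hypSum (hypSum (hypSum 0))

theorem IsometricModTwo.lifts_U3 {ψ : U3T →ₗ[ℤ] U3T} (hψ : IsometricModTwo qU3 ψ) :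
    LiftsModTwo qU3 ψ := by
  have h0 : NondegenerateModTwo (0 : QuadraticForm ℤ PUnit.{1}) := fun v _ => ⟨v, rfl⟩
  have h1 : ∀ φ, IsometricModTwo (0 : QuadraticForm ℤ PUnit.{1}) φ → LiftsModTwo 0 φ :=
    fun φ _ => ⟨LinearEquiv.refl ℤ _, fun _ => rfl, fun x => ⟨x, rfl⟩⟩
  exact LiftsModTwo.hypSum_of_nondegenerate h0.hypSum.hypSum
    (fun _ h2 => LiftsModTwo.hypSum_of_nondegenerate h0.hypSum
      (fun _ h3 => LiftsModTwo.hypSum_of_nondegenerate h0 h1 h3) h2) hψ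

section Abstract

theorem exists_two_smul_eq {X Y : Type*} [AddCommGroup X] [AddCommGroup Y]
    [IsAddTorsionFree Y] (f : X →ₗ[ℤ] Y) (h : ∀ x, ∃ y, f x = (2 : ℤ) • y) :
    ∃ g : X →ₗ[ℤ] Y, ∀ x, f x = (2 : ℤ) • g x := by
  choose g hg using h
  have hi : Function.Injective fun y : Y => (2 : ℤ) • y := smul_right_injective Y two_ne_zero
  refine ⟨{ toFun := g, map_add' := fun x y => hi ?_, map_smul' := fun c x => hi ?_ }, hg⟩
  · simp only [smul_add, ← hg, map_add]
  · simp only [RingHom.id_apply, smul_comm (2 : ℤ) c, ← hg, map_smul]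

/-- A functional on a primitive sublattice extends to the whole lattice. -/
theorem exists_extend_of_primitive {L : Type*} [AddCommGroup L] [Module.Finite ℤ L]
    (P : Submodule ℤ L) (hP : ∀ (p : L) (n : ℤ), n ≠ 0 → n • p ∈ P → p ∈ P)
    (f : P →ₗ[ℤ] ℤ) : ∃ F : L →ₗ[ℤ] ℤ, ∀ x : P, F x = f x := by
  have : Module.IsTorsionFree ℤ (L ⧸ P) := by
    refine Module.IsTorsionFree.of_smul_eq_zero fun n x hx => ?_
    obtain ⟨x, rfl⟩ := P.mkQ_surjective x
    by_cases hn : n = 0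
    · exact Or.inl hn
    · refine Or.inr ?_
      rw [← map_smul] at hx
      rw [Submodule.mkQ_apply, Submodule.Quotient.mk_eq_zero] at hx ⊢
      exact hP x n hn hx
  obtain ⟨s, hs⟩ := Module.projective_lifting_property P.mkQ LinearMap.id P.mkQ_surjective
  have hs' : ∀ x, P.mkQ (s x) = x := fun x => LinearMap.congr_fun hs x
  refine ⟨f ∘ₗ (LinearMap.id - s ∘ₗ P.mkQ).codRestrict P fun x => ?_, fun x => ?_⟩
  rotate_left
  · refine (Submodule.Quotient.mk_eq_zero P).1 ?_
    rw [← Submodule.mkQ_apply]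
    simp only [LinearMap.sub_apply, LinearMap.comp_apply, map_sub, hs',
      LinearMap.id_apply, sub_self]
  · rw [LinearMap.comp_apply]
    congr 1
    ext
    simp [(Submodule.Quotient.mk_eq_zero P).2 x.2]

/-- A full-rank sublattice has a nonzero multiple of every vector. -/
theorem exists_smul_mem_range {X L : Type*} [AddCommGroup X] [AddCommGroup L]
    [Module.Free ℤ L] [Module.Finite ℤ L] (S : X →ₗ[ℤ] L) (hS : Function.Injective S)
    (hr : Module.finrank ℤ X = Module.finrank ℤ L) (y : L) :
    ∃ d : ℤ, d ≠ 0 ∧ ∃ x, S x = d • y := by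
  have : Finite (L ⧸ LinearMap.range S) := Submodule.finiteQuotientOfFreeOfRankEq _
    ((LinearMap.finrank_range_of_inj hS).trans hr)
  refine ⟨Nat.card (L ⧸ LinearMap.range S), by simp [Nat.card_pos.ne'], ?_⟩
  rw [← LinearMap.mem_range, ← Submodule.Quotient.mk_eq_zero, Submodule.Quotient.mk_smul,
    natCast_zsmul]
  exact card_nsmul_eq_zero'

theorem exists_polar_eq_hypSum {V : Type*} [AddCommGroup V] {Q : QuadraticForm ℤ V}
    (hQ : ∀ h : V →ₗ[ℤ] ℤ, ∃ x, ∀ y, QuadraticMap.polar Q x y = h y)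
    (h : ((ℤ × ℤ) × V) →ₗ[ℤ] ℤ) : ∃ x, ∀ y, QuadraticMap.polar (hypSum Q) x y = h y := by
  obtain ⟨x, hx⟩ := hQ (h ∘ₗ LinearMap.inr ℤ _ _)
  refine ⟨((h ((0, 1), 0), h ((1, 0), 0)), x), ?_⟩
  rintro ⟨⟨a, b⟩, v⟩
  have : (((a, b), v) : (ℤ × ℤ) × V) =
      a • ((1, 0), 0) + b • ((0, 1), 0) + (0, v) := by ext <;> simp
  rw [polar_hypSum, hx, this]
  simp only [map_add, map_smul, LinearMap.comp_apply, LinearMap.inr_apply, smul_eq_mul]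
  ring

end Abstract

section UE8

/-- The form `bUE8` as a bilinear map. -/
def formUE8 : UE8T →ₗ[ℤ] UE8T →ₗ[ℤ] ℤ :=
  LinearMap.mk₂ ℤ bUE8
    (fun x y z => by
      simp only [bUE8, bU, bE8, Prod.fst_add, Prod.snd_add, add_dotProduct, Pi.add_apply,
        Fin.sum_univ_three]
      ring)
    (fun c x z => by
      simp only [bUE8, bU, bE8, Prod.smul_fst, Prod.smul_snd, smul_dotProduct, Pi.smul_apply,
        Fin.sum_univ_three, smul_eq_mul]
      ring)
    (fun x y z => by
      simp only [bUE8, bU, bE8, Prod.fst_add, Prod.snd_add, mulVec_add, dotProduct_add,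
        Pi.add_apply, Fin.sum_univ_three]
      ring)
    (fun c x z => by
      simp only [bUE8, bU, bE8, Prod.smul_fst, Prod.smul_snd, mulVec_smul, dotProduct_smul,
        Pi.smul_apply, Fin.sum_univ_three, smul_eq_mul]
      ring)

theorem formUE8_apply (x y : UE8T) : formUE8 x y = bUE8 x y := rfl

theorem bUE8_comm (x y : UE8T) : bUE8 x y = bUE8 y x := by
  have h : bE8 x.2 y.2 = bE8 y.2 x.2 := by
    rw [bE8, bE8, dotProduct_mulVec, ← mulVec_transpose, CartanMatrix.E₈_transpose,
      dotProduct_comm]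
  simp only [bUE8, bU, h, Fin.sum_univ_three]
  ring

theorem bUE8_self_even (x : UE8T) : ∃ t, bUE8 x x = 2 * t := by
  obtain ⟨u, v⟩ := x
  refine ⟨u 0 0 * u 0 1 + u 1 0 * u 1 1 + u 2 0 * u 2 1 -
    (v 0 ^ 2 + v 1 ^ 2 + v 2 ^ 2 + v 3 ^ 2 + v 4 ^ 2 + v 5 ^ 2 + v 6 ^ 2 + v 7 ^ 2 -
      v 0 * v 2 - v 1 * v 3 - v 2 * v 3 - v 3 * v 4 - v 4 * v 5 - v 5 * v 6 - v 6 * v 7), ?_⟩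
  simp [bUE8, bU, bE8, CartanMatrix.E₈, mulVec, dotProduct, Fin.sum_univ_succ]
  ring

theorem exists_bUE8_eq (f : UE8T →ₗ[ℤ] ℤ) : ∃ p, ∀ x, bUE8 p x = f x := by
  have hE : IsUnit CartanMatrix.E₈.det := by simp [CartanMatrix.E₈_det]
  let w : Fin 8 → ℤ := fun i => f (0, Pi.single i 1)
  refine ⟨(fun i k => f (Pi.single i (Pi.single (1 - k) 1), 0),
    -(CartanMatrix.E₈⁻¹ *ᵥ w)), fun x => ?_⟩
  rw [← formUE8_apply]
  generalize hp : formUE8 _ = F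
  refine LinearMap.congr_fun (LinearMap.prod_ext (LinearMap.pi_ext' fun i => LinearMap.pi_ext'
    fun k => LinearMap.ext_ring ?_) (LinearMap.pi_ext' fun i => LinearMap.ext_ring ?_)) x
  · subst hp
    simp only [LinearMap.comp_apply, LinearMap.single_apply, LinearMap.inl_apply, formUE8_apply]
    simp only [bUE8, bU, bE8, mulVec_zero, dotProduct_zero, neg_zero, add_zero]
    fin_cases k <;> fin_cases i <;> simp [Fin.sum_univ_three]
  · subst hp
    simp only [LinearMap.comp_apply, LinearMap.single_apply, LinearMap.inr_apply, formUE8_apply]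
    simp only [bUE8, bU, bE8]
    rw [dotProduct_mulVec, neg_vecMul, ← mulVec_transpose, CartanMatrix.E₈_transpose,
      mulVec_mulVec, Matrix.mul_nonsing_inv _ hE]
    simp [w]

theorem eq_zero_of_bUE8 (y : UE8T) (h : ∀ x, bUE8 x y = 0) : y = 0 := by
  ext i k
  · obtain ⟨p, hp⟩ := exists_bUE8_eq
      (LinearMap.proj k ∘ₗ LinearMap.proj i ∘ₗ LinearMap.fst ℤ _ _)
    simpa [h] using (hp y).symm
  · obtain ⟨p, hp⟩ := exists_bUE8_eq (LinearMap.proj i ∘ₗ LinearMap.snd ℤ _ _)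
    simpa [h] using (hp y).symm

theorem finrank_UE8T : Module.finrank ℤ UE8T = 14 := by
  simp [Module.finrank_pi_fintype]

/-- The orthogonal complement of a full-rank sublattice vanishes. -/
theorem eq_zero_of_orthogonal {X : Type*} [AddCommGroup X] (S : X →ₗ[ℤ] UE8T)
    (hS : Function.Injective S) (hr : Module.finrank ℤ X = 14) (y : UE8T)
    (h : ∀ x, bUE8 y (S x) = 0) : y = 0 := by
  refine eq_zero_of_bUE8 y fun z => ?_
  obtain ⟨d, hd, x, hx⟩ := exists_smul_mem_range S hS (hr.trans finrank_UE8T.symm) z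
  have h := h x
  rw [hx, ← formUE8_apply, map_smul, formUE8_apply, bUE8_comm] at h
  exact (mul_eq_zero.1 h).resolve_left hd

/-- An isometric endomorphism of `U³ ⊕ E8(-1)` is bijective. -/
theorem bijective_of_isometric (β : UE8T →ₗ[ℤ] UE8T)
    (hβ : ∀ x y, bUE8 (β x) (β y) = bUE8 x y) : Function.Bijective β := by
  have hi : Function.Injective β := by
    rw [injective_iff_map_eq_zero]
    intro y hy
    refine eq_zero_of_bUE8 y fun x => ?_
    rw [← hβ, hy, ← formUE8_apply, map_zero]
  refine ⟨hi, fun y => ?_⟩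
  obtain ⟨p, hp⟩ := exists_bUE8_eq (formUE8 y ∘ₗ β)
  refine ⟨p, sub_eq_zero.1 (eq_zero_of_orthogonal β hi finrank_UE8T _ fun x => ?_)⟩
  rw [← formUE8_apply, map_sub, LinearMap.sub_apply, formUE8_apply, formUE8_apply, hβ, hp]
  simp [formUE8_apply]

end UE8

section Embedding

/-- The isomorphism from `U3T` onto `U(2)³`, as a map to the ambient space. -/
def iotaK : U3T →ₗ[ℤ] Kv where
  toFun x := ![![(x.1.1 : ℚ), (x.1.2 : ℚ)], ![(x.2.1.1 : ℚ), (x.2.1.2 : ℚ)],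
    ![(x.2.2.1.1 : ℚ), (x.2.2.1.2 : ℚ)]]
  map_add' x y := by ext i k; fin_cases i <;> fin_cases k <;> simp
  map_smul' c x := by ext i k; fin_cases i <;> fin_cases k <;> simp

theorem iotaK_apply (a b c d e f : ℤ) (u : PUnit) :
    iotaK ((a, b), ((c, d), ((e, f), u))) =
      ![![(a : ℚ), (b : ℚ)], ![(c : ℚ), (d : ℚ)], ![(e : ℚ), (f : ℚ)]] := rfl

theorem range_iotaK : LinearMap.range iotaK = Kmod := by
  apply le_antisymm
  · rintro _ ⟨⟨⟨a, b⟩, ⟨c, d⟩, ⟨e, f⟩, u⟩, rfl⟩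
    have h : iotaK ((a, b), ((c, d), ((e, f), u))) =
        ∑ p : Fin 3 × Fin 2, (![![a, b], ![c, d], ![e, f]] p.1 p.2) •
          (Pi.single p.1 (Pi.single p.2 (1 : ℚ)) : Kv) := by
      rw [iotaK_apply]
      ext i k
      fin_cases i <;> fin_cases k <;>
        simp [Fintype.sum_prod_type, Fin.sum_univ_succ, Finset.sum_apply]
    rw [h]
    exact Submodule.sum_mem _ fun p _ => Submodule.smul_mem _ _ (Submodule.subset_span ⟨p, rfl⟩)
  · refine Submodule.span_le.2 ?_
    rintro _ ⟨⟨i, k⟩, rfl⟩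
    let δ : Fin 3 → Fin 2 → ℤ := Pi.single i (Pi.single k 1)
    refine ⟨((δ 0 0, δ 0 1), ((δ 1 0, δ 1 1), ((δ 2 0, δ 2 1), ⟨⟩))), ?_⟩
    rw [iotaK_apply]
    ext i' k'
    fin_cases i <;> fin_cases k <;> fin_cases i' <;> fin_cases k' <;> simp [δ]

theorem bK_iotaK (x y : U3T) :
    bK (iotaK x) (iotaK y) = 2 * (QuadraticMap.polar qU3 x y : ℤ) := by
  obtain ⟨⟨a, b⟩, ⟨c, d⟩, ⟨e, f⟩, u⟩ := x
  obtain ⟨⟨a', b'⟩, ⟨c', d'⟩, ⟨e', f'⟩, u'⟩ := y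
  rw [iotaK_apply, iotaK_apply, polar_hypSum, polar_hypSum, polar_hypSum]
  simp [bK, Fin.sum_univ_succ, QuadraticMap.polar]
  ring

theorem iotaK_injective : Function.Injective iotaK := by
  rintro ⟨⟨a, b⟩, ⟨c, d⟩, ⟨e, f⟩, u⟩ ⟨⟨a', b'⟩, ⟨c', d'⟩, ⟨e', f'⟩, u'⟩ h
  have hcoord := fun i k => congrFun (congrFun h i) k
  simpa [iotaK_apply, Fin.forall_fin_succ, and_assoc] using hcoord

/-- Coordinates on `U(2)³ ⊕ N`: the first factor in terms of the standard basis. -/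
def toMlat : (U3T × Nik) →ₗ[ℤ] Mlat :=
  ((iotaK ∘ₗ LinearMap.fst ℤ U3T Nik).prod (Nik.subtype ∘ₗ LinearMap.snd ℤ U3T Nik)).codRestrict
    Mlat fun x => ⟨by rw [← range_iotaK]; exact ⟨x.1, rfl⟩, x.2.2⟩

theorem coe_toMlat (x : U3T) (n : Nik) : (toMlat (x, n) : Vt) = (iotaK x, (n : Qv)) := rfl

theorem toMlat_bijective : Function.Bijective toMlat := by
  constructor
  · rintro ⟨x, n⟩ ⟨y, m⟩ h
    have h' := congrArg Subtype.val h
    rw [coe_toMlat, coe_toMlat, Prod.mk.injEq] at h'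
    exact Prod.ext (iotaK_injective h'.1) (Subtype.ext h'.2)
  · rintro ⟨⟨k, n⟩, hk, hn⟩
    simp only [← range_iotaK] at hk
    obtain ⟨x, rfl⟩ := hk
    exact ⟨(x, ⟨n, hn⟩), rfl⟩

/-- `toMlat` as an isomorphism. -/
noncomputable def equivMlat : (U3T × Nik) ≃ₗ[ℤ] Mlat :=
  LinearEquiv.ofBijective toMlat toMlat_bijective

theorem coe_equivMlat (x : U3T) (n : Nik) :
    (equivMlat (x, n) : Vt) = (iotaK x, (n : Qv)) := rfl

theorem bV_equivMlat (x y : U3T) (n m : Nik) :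
    bV (equivMlat (x, n) : Vt) (equivMlat (y, m) : Vt) =
      2 * (QuadraticMap.polar qU3 x y : ℤ) + bN n m := by
  rw [coe_equivMlat, coe_equivMlat, bV, bK_iotaK]

/-- Integral vectors lie in the Nikulin lattice. -/
def intNik : (Fin 8 → ℤ) →ₗ[ℤ] Nik where
  toFun v := ⟨fun i => v i, by
    have h : (fun i => (v i : ℚ)) = ∑ i, v i • Nvec i := by
      ext k
      simp [Nvec, Finset.sum_apply, Pi.single_apply]
    rw [h]
    exact Submodule.sum_mem _ fun i _ => Submodule.smul_mem _ _
      (Submodule.subset_span (Set.mem_insert_of_mem _ ⟨i, rfl⟩))⟩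
  map_add' v w := by ext; simp
  map_smul' c v := by ext; simp

theorem coe_intNik (v : Fin 8 → ℤ) : (intNik v : Qv) = fun i => (v i : ℚ) := rfl

/-- The integral `N`-component of twice a glue vector. -/
def glueInt : U3T →ₗ[ℤ] (Fin 8 → ℤ) where
  toFun x := ![x.1.1 + x.1.2 + x.2.1.1 + x.2.1.2, x.1.1 + x.1.2 + x.2.2.1.1,
    x.1.1 + x.2.2.1.2, x.1.2 + x.2.2.1.2, x.2.1.1 + x.2.1.2 + x.2.2.1.2,
    x.2.1.1 + x.2.2.1.1, x.2.1.2 + x.2.2.1.1,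
    x.1.1 + x.1.2 + x.2.1.1 + x.2.1.2 + x.2.2.1.1 + x.2.2.1.2]
  map_add' x y := by ext i; fin_cases i <;> simp <;> ring
  map_smul' c x := by ext i; fin_cases i <;> simp <;> ring

theorem glueInt_apply (a b c d e f : ℤ) (u : PUnit) :
    glueInt ((a, b), ((c, d), ((e, f), u))) = ![a + b + c + d, a + b + e, a + f, b + f,
      c + d + f, c + e, d + e, a + b + c + d + e + f] := rfl

/-- The `N`-component of twice a glue vector. -/
def glueNik : U3T →ₗ[ℤ] Nik := intNik ∘ₗ glueInt

theorem coe_glueNik (x : U3T) : (glueNik x : Qv) = fun i => (glueInt x i : ℚ) := rfl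

/-- Half of `glueNik x` lies in the dual of the Nikulin lattice. -/
theorem bN_glueNik_even (x : U3T) (n : Nik) : ∃ k : ℤ, bN (glueNik x) n = 2 * k := by
  obtain ⟨n, hn⟩ := n
  refine Submodule.span_induction (p := fun n _ => ∃ k : ℤ, bN (glueNik x) n = 2 * k)
    ?_ ?_ ?_ ?_ hn
  · rintro _ (rfl | ⟨i, rfl⟩)
    · obtain ⟨⟨a, b⟩, ⟨c, d⟩, ⟨e, f⟩, u⟩ := x
      refine ⟨-2 * (a + b + c + d + e + f), ?_⟩
      simp [bN, coe_glueNik, glueInt_apply, Nhat, Fin.sum_univ_succ]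
      ring
    · refine ⟨-glueInt x i, ?_⟩
      simp [bN, coe_glueNik, Nvec, Pi.single_apply]
  · exact ⟨0, by simp [bN]⟩
  · rintro y z _ _ ⟨k, hk⟩ ⟨l, hl⟩
    refine ⟨k + l, ?_⟩
    push_cast
    rw [mul_add, ← hk, ← hl]
    simp only [bN, Pi.add_apply, mul_add, Finset.sum_add_distrib]
  · rintro c y _ ⟨k, hk⟩
    refine ⟨c * k, ?_⟩
    push_cast
    rw [mul_left_comm, ← hk]
    simp only [bN, Pi.smul_apply, zsmul_eq_mul, mul_left_comm _ (c : ℚ), ← Finset.mul_sum]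

theorem bN_glueNik_self (x : U3T) :
    ∃ s : ℤ, bN (glueNik x) (glueNik x) = -4 * (qU3 x : ℤ) + 8 * s := by
  obtain ⟨⟨a, b⟩, ⟨c, d⟩, ⟨e, f⟩, u⟩ := x
  refine ⟨-(a^2 + b^2 + c^2 + d^2 + e^2 + f^2 + a*b + a*c + a*d + a*e + a*f + b*c + b*d + b*e
    + b*f + c*d + c*e + c*f + d*e + d*f), ?_⟩
  simp [bN, coe_glueNik, glueInt_apply, Fin.sum_univ_succ, hypSum_apply]
  ring

end Embedding

section Overlattice

variable (j : Mlat →ₗ[ℤ] UE8T)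

/-- The embedding `j` in coordinates. -/
noncomputable def jCoord : (U3T × Nik) →ₗ[ℤ] UE8T := j ∘ₗ equivMlat.toLinearMap

theorem jCoord_apply (x : U3T × Nik) : jCoord j x = j (equivMlat x) := rfl

variable {j}

theorem bUE8_jCoord (hj : ∀ x y : Mlat, (bUE8 (j x) (j y) : ℚ) = bV (x : Vt) (y : Vt))
    (x y : U3T) (n m : Nik) :
    (bUE8 (jCoord j (x, n)) (jCoord j (y, m)) : ℚ) =
      2 * (QuadraticMap.polar qU3 x y : ℤ) + bN n m := by
  rw [jCoord_apply, jCoord_apply, hj, bV_equivMlat]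

theorem bUE8_add_right (x y z : UE8T) : bUE8 x (y + z) = bUE8 x y + bUE8 x z :=
  (formUE8 x).map_add y z

theorem bUE8_sub_left (x y z : UE8T) : bUE8 (x - y) z = bUE8 x z - bUE8 y z := by
  rw [← formUE8_apply, map_sub]; rfl

theorem bUE8_smul_left (c : ℤ) (x z : UE8T) : bUE8 (c • x) z = c * bUE8 x z := by
  rw [← formUE8_apply, map_smul]; rfl

theorem bUE8_smul_right (c : ℤ) (x z : UE8T) : bUE8 x (c • z) = c * bUE8 x z :=
  (formUE8 x).map_smul c z

theorem exists_polar_qU3_eq (h : U3T →ₗ[ℤ] ℤ) :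
    ∃ x, ∀ y, QuadraticMap.polar qU3 x y = h y :=
  exists_polar_eq_hypSum (exists_polar_eq_hypSum (exists_polar_eq_hypSum fun h =>
    ⟨0, fun y => by rw [Subsingleton.elim y 0, map_zero, QuadraticMap.polar_zero_right]⟩)) h

/-- The image of an embedding of `U(2)³ ⊕ N` has trivial orthogonal complement. -/
theorem orthogonal_jCoord (hinj : Function.Injective j) (y : UE8T)
    (h : ∀ x n, bUE8 y (jCoord j (x, n)) = 0) : y = 0 := by
  let S : (U3T × (Fin 8 → ℤ)) →ₗ[ℤ] UE8T :=
    jCoord j ∘ₗ LinearMap.prodMap LinearMap.id intNik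
  have hS : Function.Injective S := by
    have hi : Function.Injective intNik := fun v w hvw => by
      have h' := congrArg Subtype.val hvw
      rw [coe_intNik, coe_intNik] at h'
      ext i
      exact_mod_cast congrFun h' i
    exact (hinj.comp equivMlat.injective).comp (Function.injective_id.prodMap hi)
  exact eq_zero_of_orthogonal S hS
    (by simp [Module.finrank_zero_of_subsingleton (R := ℤ) (M := PUnit.{1})]) y
    fun x => h x.1 (intNik x.2)

theorem exists_glue (hinj : Function.Injective j)
    (hj : ∀ x y : Mlat, (bUE8 (j x) (j y) : ℚ) = bV (x : Vt) (y : Vt))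
    (hprim : ∀ (p : UE8T) (n : ℤ), n ≠ 0 →
      n • p ∈ Submodule.map j (Nsub.comap Mlat.subtype) →
      p ∈ Submodule.map j (Nsub.comap Mlat.subtype)) (c : U3T) :
    ∃ (x : U3T) (p : UE8T), (2 : ℤ) • p = jCoord j (x, glueNik c) := by
  have hP : ∀ q ∈ Submodule.map j (Nsub.comap Mlat.subtype), ∃ n, q = jCoord j (0, n) := by
    rintro _ ⟨m, hm, rfl⟩
    obtain ⟨⟨x, n⟩, rfl⟩ := equivMlat.surjective m
    have hx : iotaK x = 0 := hm.1
    rw [iotaK_injective (hx.trans (map_zero _).symm)]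
    exact ⟨n, rfl⟩
  have hP' : ∀ n, jCoord j (0, n) ∈ Submodule.map j (Nsub.comap Mlat.subtype) := fun n =>
    ⟨equivMlat (0, n), ⟨map_zero iotaK, n.2⟩, rfl⟩
  obtain ⟨f, hf⟩ := exists_two_smul_eq
    (formUE8 (jCoord j (0, glueNik c)) ∘ₗ
      (Submodule.map j (Nsub.comap Mlat.subtype)).subtype) (by
    rintro ⟨q, hq⟩
    obtain ⟨n, rfl⟩ := hP q hq
    obtain ⟨k, hk⟩ := bN_glueNik_even c n
    refine ⟨k, ?_⟩
    have h := bUE8_jCoord hj 0 0 (glueNik c) n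
    rw [hk, QuadraticMap.polar_zero_left] at h
    simp only [Int.cast_zero, mul_zero, zero_add] at h
    exact_mod_cast h)
  obtain ⟨F, hF⟩ := exists_extend_of_primitive _ hprim f
  obtain ⟨p, hp⟩ := exists_bUE8_eq F
  obtain ⟨x, hx⟩ := exists_polar_qU3_eq (formUE8 p ∘ₗ jCoord j ∘ₗ LinearMap.inl ℤ _ _)
  refine ⟨x, p, sub_eq_zero.1 (orthogonal_jCoord hinj _ fun y n => ?_)⟩
  have hpn : bUE8 (jCoord j (0, glueNik c)) (jCoord j (0, n)) =
      2 * bUE8 p (jCoord j (0, n)) := by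
    have h := hf ⟨_, hP' n⟩
    rw [hp, hF ⟨_, hP' n⟩]
    exact h
  have h0 := bUE8_jCoord hj 0 0 (glueNik c) n
  have h1 := bUE8_jCoord hj x y (glueNik c) n
  have h2 : bUE8 p (jCoord j (y, n)) =
      QuadraticMap.polar qU3 x y + bUE8 p (jCoord j (0, n)) := by
    rw [hx, show (y, n) = (y, 0) + (0, n) by simp, map_add, bUE8_add_right]
    rfl
  rw [hpn, QuadraticMap.polar_zero_left] at h0
  simp only [Int.cast_zero, mul_zero, zero_add] at h0
  rw [← h0] at h1
  rw [bUE8_sub_left, bUE8_smul_left, h2, sub_eq_zero]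
  have h3 : bUE8 (jCoord j (x, glueNik c)) (jCoord j (y, n)) =
      2 * QuadraticMap.polar qU3 x y + 2 * bUE8 p (jCoord j (0, n)) := by exact_mod_cast h1
  rw [h3, mul_add]

/-- The gluing data of `j` can be chosen linearly. -/
theorem exists_linear_glue (hinj : Function.Injective j)
    (hj : ∀ x y : Mlat, (bUE8 (j x) (j y) : ℚ) = bV (x : Vt) (y : Vt))
    (hprim : ∀ (p : UE8T) (n : ℤ), n ≠ 0 →
      n • p ∈ Submodule.map j (Nsub.comap Mlat.subtype) →
      p ∈ Submodule.map j (Nsub.comap Mlat.subtype)) :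
    ∃ (ψ : U3T →ₗ[ℤ] U3T) (P : U3T →ₗ[ℤ] UE8T),
      ∀ c, (2 : ℤ) • P c = jCoord j (ψ c, glueNik c) := by
  let R : Submodule ℤ (U3T × (U3T × UE8T)) := LinearMap.ker
    ((2 : ℤ) • (LinearMap.snd ℤ U3T UE8T ∘ₗ LinearMap.snd ℤ U3T (U3T × UE8T)) -
      jCoord j ∘ₗ ((LinearMap.fst ℤ U3T UE8T ∘ₗ LinearMap.snd ℤ U3T (U3T × UE8T)).prod
        (glueNik ∘ₗ LinearMap.fst ℤ U3T (U3T × UE8T))))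
  have hR : Function.Surjective (LinearMap.fst ℤ U3T (U3T × UE8T) ∘ₗ R.subtype) := fun c => by
    obtain ⟨x, p, h⟩ := exists_glue hinj hj hprim c
    exact ⟨⟨(c, (x, p)), LinearMap.mem_ker.2 (sub_eq_zero.2 h)⟩, rfl⟩
  obtain ⟨s, hs⟩ := Module.projective_lifting_property _ LinearMap.id hR
  refine ⟨LinearMap.fst ℤ _ _ ∘ₗ LinearMap.snd ℤ _ _ ∘ₗ R.subtype ∘ₗ s,
    LinearMap.snd ℤ _ _ ∘ₗ LinearMap.snd ℤ _ _ ∘ₗ R.subtype ∘ₗ s, fun c => ?_⟩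
  have h1 : ((s c : U3T × (U3T × UE8T))).1 = c := LinearMap.congr_fun hs c
  have h2 := sub_eq_zero.1 (LinearMap.mem_ker.1 (s c).2)
  have h3 : (2 : ℤ) • ((s c : U3T × (U3T × UE8T))).2.2 =
      jCoord j ((s c : U3T × (U3T × UE8T)).2.1, glueNik (s c : U3T × (U3T × UE8T)).1) := h2
  rw [h1] at h3
  exact h3

theorem isometricModTwo_of_glue
    (hj : ∀ x y : Mlat, (bUE8 (j x) (j y) : ℚ) = bV (x : Vt) (y : Vt))
    {ψ : U3T →ₗ[ℤ] U3T} {P : U3T →ₗ[ℤ] UE8T}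
    (h : ∀ c, (2 : ℤ) • P c = jCoord j (ψ c, glueNik c)) : IsometricModTwo qU3 ψ := fun c => by
  have h1 := bUE8_jCoord hj (ψ c) (ψ c) (glueNik c) (glueNik c)
  obtain ⟨t, ht⟩ := bUE8_self_even (P c)
  obtain ⟨s, hs⟩ := bN_glueNik_self c
  have hp : QuadraticMap.polar qU3 (ψ c) (ψ c) = 2 * qU3 (ψ c) := by
    rw [QuadraticMap.polar_self, two_nsmul, two_mul]
  rw [← h, bUE8_smul_left, bUE8_smul_right, ht, hs, hp] at h1
  have h2 : 2 * (2 * (2 * t)) = 2 * (2 * qU3 (ψ c)) + (-4 * qU3 c + 8 * s) := by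
    exact_mod_cast h1
  unfold Int.ModEq
  omega

/-- Every element of `L0` is half of an element of `Mlat` that a suitable map `h` on
`Mlat` sends to an even vector. -/
theorem L0_two_smul {h : Mlat →ₗ[ℤ] UE8T}
    (hh : ∀ c, ∃ l, h (equivMlat (c, glueNik c)) = (2 : ℤ) • l) (x : Vt) (hx : x ∈ L0) :
    ∃ m : Mlat, (m : Vt) = (2 : ℤ) • x ∧ ∃ l, h m = (2 : ℤ) • l := by
  let T : Submodule ℤ Vt :=
    { carrier := {x | ∃ m : Mlat, (m : Vt) = (2 : ℤ) • x ∧ ∃ l, h m = (2 : ℤ) • l}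
      add_mem' := by
        rintro x y ⟨m, hm, l, hl⟩ ⟨m', hm', l', hl'⟩
        exact ⟨m + m', by rw [Submodule.coe_add, hm, hm', smul_add], l + l', by
          rw [map_add, hl, hl', smul_add]⟩
      zero_mem' := ⟨0, by simp, 0, by simp⟩
      smul_mem' := by
        rintro c x ⟨m, hm, l, hl⟩
        exact ⟨c • m, by rw [Submodule.coe_smul, hm, smul_comm], c • l, by
          rw [map_smul, hl, smul_comm]⟩ }
  have hT : L0 ≤ T := by
    refine sup_le (fun x hx => ?_) (Submodule.span_le.2 ?_)
    · exact ⟨(2 : ℤ) • ⟨x, hx⟩, rfl, h ⟨x, hx⟩, map_smul _ _ _⟩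
    · have key : ∀ (c : U3T) (x : Vt), (iotaK c, (glueNik c : Qv)) = (2 : ℤ) • x → x ∈ T :=
        fun c x hx => ⟨equivMlat (c, glueNik c), hx, hh c⟩
      rintro x (rfl | rfl | rfl | rfl | rfl | rfl)
      · refine key ((1, 0), ((0, 0), ((0, 0), ⟨⟩))) _ ?_
        rw [iotaK_apply, coe_glueNik, glueInt_apply]
        ext i k
        · fin_cases i <;> fin_cases k <;> simp [eKv]
        · fin_cases i <;> simp [Nvec]
      · refine key ((0, 0), ((1, 0), ((0, 0), ⟨⟩))) _ ?_
        rw [iotaK_apply, coe_glueNik, glueInt_apply]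
        ext i k
        · fin_cases i <;> fin_cases k <;> simp [eKv]
        · fin_cases i <;> simp [Nvec]
      · refine key ((0, 0), ((0, 0), ((1, 0), ⟨⟩))) _ ?_
        rw [iotaK_apply, coe_glueNik, glueInt_apply]
        ext i k
        · fin_cases i <;> fin_cases k <;> simp [eKv]
        · fin_cases i <;> simp [Nvec]
      · refine key ((0, 1), ((0, 0), ((0, 0), ⟨⟩))) _ ?_
        rw [iotaK_apply, coe_glueNik, glueInt_apply]
        ext i k
        · fin_cases i <;> fin_cases k <;> simp [fKv]
        · fin_cases i <;> simp [Nvec]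
      · refine key ((0, 0), ((0, 1), ((0, 0), ⟨⟩))) _ ?_
        rw [iotaK_apply, coe_glueNik, glueInt_apply]
        ext i k
        · fin_cases i <;> fin_cases k <;> simp [fKv]
        · fin_cases i <;> simp [Nvec]
      · refine key ((0, 0), ((0, 0), ((0, 1), ⟨⟩))) _ ?_
        rw [iotaK_apply, coe_glueNik, glueInt_apply]
        ext i k
        · fin_cases i <;> fin_cases k <;> simp [fKv]
        · fin_cases i <;> simp [Nvec]
  exact hT hx

end Overlattice

/-- any isometric embedding `j : U(2)³ ⊕ N → U³ ⊕ E8(-1)` whose restriction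
to `{0} ⊕ N` has primitive image differs from the embedding `j₀` (the inclusion into
`L₀` composed with an isometry `g : L₀ ≅ U³ ⊕ E8(-1)`) by isometries `α` of `U(2)³ ⊕ N`
and `β` of `U³ ⊕ E8(-1)`. -/
theorem embedding_U2N_in_U3E8_unique (hML : Mlat ≤ L0)
    (g : L0 ≃ₗ[ℤ] UE8T)
    (hg : ∀ x y : L0, (bUE8 (g x) (g y) : ℚ) = bV (x : Vt) (y : Vt))
    (j : Mlat →ₗ[ℤ] UE8T) (hinj : Function.Injective j)
    (hj : ∀ x y : Mlat, (bUE8 (j x) (j y) : ℚ) = bV (x : Vt) (y : Vt))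
    (hprim : ∀ (p : UE8T) (n : ℤ), n ≠ 0 →
      n • p ∈ Submodule.map j (Nsub.comap Mlat.subtype) →
      p ∈ Submodule.map j (Nsub.comap Mlat.subtype)) :
    ∃ (α : Mlat ≃ₗ[ℤ] Mlat) (β : UE8T ≃ₗ[ℤ] UE8T),
      (∀ x y : Mlat, bV ((α x : Mlat) : Vt) ((α y : Mlat) : Vt) = bV (x : Vt) (y : Vt)) ∧
      (∀ x y : UE8T, bUE8 (β x) (β y) = bUE8 x y) ∧
      (∀ m : Mlat, j (α m) = β (g (Submodule.inclusion hML m))) := by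
  obtain ⟨ψ, P, hP⟩ := exists_linear_glue hinj hj hprim
  obtain ⟨A, hA, hA'⟩ := (isometricModTwo_of_glue hj hP).lifts_U3
  let α : Mlat ≃ₗ[ℤ] Mlat :=
    equivMlat.symm ≪≫ₗ LinearEquiv.prodCongr A (LinearEquiv.refl ℤ Nik) ≪≫ₗ equivMlat
  have hα : ∀ x n, α (equivMlat (x, n)) = equivMlat (A x, n) := fun x n => by simp [α]
  have hαb : ∀ x y : Mlat, bV (α x : Vt) (α y : Vt) = bV (x : Vt) (y : Vt) := by
    intro x y
    obtain ⟨⟨x, n⟩, rfl⟩ := equivMlat.surjective x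
    obtain ⟨⟨y, m⟩, rfl⟩ := equivMlat.surjective y
    rw [hα, hα, bV_equivMlat, bV_equivMlat]
    simp only [QuadraticMap.polar, ← map_add A, hA]
  have hglue : ∀ c, ∃ l, (j ∘ₗ α.toLinearMap) (equivMlat (c, glueNik c)) = (2 : ℤ) • l := by
    intro c
    obtain ⟨y, hy⟩ := hA' c
    refine ⟨P c + jCoord j (y, 0), ?_⟩
    rw [smul_add, hP, ← map_smul, ← map_add, LinearMap.comp_apply, LinearEquiv.coe_coe, hα, hy]
    simp [jCoord_apply]
  have htwo := fun x : L0 => L0_two_smul hglue x x.2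
  have hmem : ∀ x : L0, ((2 : ℤ) • L0.subtype) x ∈ Mlat := fun x => by
    obtain ⟨m, hm, -⟩ := htwo x
    have h := m.2
    rw [hm] at h
    exact h
  let D : L0 →ₗ[ℤ] Mlat := LinearMap.codRestrict Mlat ((2 : ℤ) • L0.subtype) hmem
  have hD : ∀ x, (D x : Vt) = (2 : ℤ) • (x : Vt) := fun _ => rfl
  obtain ⟨β₀, hβ₀⟩ := exists_two_smul_eq (j ∘ₗ α.toLinearMap ∘ₗ D) fun x => by
    obtain ⟨m, hm, l, hl⟩ := htwo x
    rw [show m = D x from Subtype.ext hm] at hl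
    exact ⟨l, hl⟩
  have hβ : ∀ x y : UE8T, bUE8 ((β₀ ∘ₗ g.symm.toLinearMap) x) ((β₀ ∘ₗ g.symm.toLinearMap) y) =
      bUE8 x y := by
    intro x y
    obtain ⟨x, rfl⟩ := g.surjective x
    obtain ⟨y, rfl⟩ := g.surjective y
    have h1 := hj (α (D x)) (α (D y))
    rw [hαb, hD, hD] at h1
    have hx : j (α (D x)) = (2 : ℤ) • β₀ x := hβ₀ x
    have hy : j (α (D y)) = (2 : ℤ) • β₀ y := hβ₀ y
    have h2 : bV ((2 : ℤ) • (x : Vt)) ((2 : ℤ) • (y : Vt)) = 2 * (2 * bV x y) := by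
      simp [bV, bK, bN, Fin.sum_univ_succ]
      ring
    rw [hx, hy, h2, ← hg, bUE8_smul_left, bUE8_smul_right] at h1
    have h3 : 2 * (2 * bUE8 (β₀ x) (β₀ y)) = 2 * (2 * bUE8 (g x) (g y)) := by exact_mod_cast h1
    simp only [LinearMap.comp_apply, LinearEquiv.coe_coe, LinearEquiv.symm_apply_apply]
    omega
  refine ⟨α, LinearEquiv.ofBijective _ (bijective_of_isometric _ hβ), hαb, hβ, fun m => ?_⟩
  have h1 := hβ₀ (Submodule.inclusion hML m)
  have h2 : D (Submodule.inclusion hML m) = (2 : ℤ) • m := rfl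
  simp only [LinearMap.comp_apply, h2, map_smul] at h1
  have h3 := smul_right_injective UE8T (two_ne_zero (α := ℤ)) h1
  simpa using h3
end

section
/- The ℚ-linear map (N ⊕ N) ⊗ ℚ → ℚ^16 determined by (Nᵢ, 0) ↦ eᵢ + e_{i+8} and (0, Nᵢ) ↦ eᵢ − e_{i+8} for i = 1, …, 8 (so that (N̂, 0) ↦ ½(e₁+⋯+e₁₆) and (0, N̂) ↦ ½(e₁+⋯+e₈−e₉−⋯−e₁₆)) restricts to an isometric embedding of N ⊕ N into Γ₁₆(−1), and under this embedding the images of N ⊕ {0} and of {0} ⊕ N are primitive sublattices of Γ₁₆(−1). -/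
open Finset

/-- The lattice `N ⊕ N` inside `(N ⊕ N) ⊗ ℚ`. -/
def NN : Submodule ℤ (Qv × Qv) := Nik.prod Nik

/-- The orthogonal direct sum form on `(N ⊕ N) ⊗ ℚ`. -/
def bNN (x y : Qv × Qv) : ℚ := bN x.1 y.1 + bN x.2 y.2

/-- The lattice `Γ₁₆ = {x ∈ ℚ^16 : 2xᵢ ∈ ℤ, xᵢ - xⱼ ∈ ℤ, ∑ xᵢ ∈ 2ℤ}`. -/
def Gamma16 : Submodule ℤ (Fin 16 → ℚ) where
  carrier := {x | (∀ i, ∃ k : ℤ, 2 * x i = k) ∧ (∀ i j, ∃ k : ℤ, x i - x j = k) ∧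
    ∃ k : ℤ, ∑ i, x i = 2 * k}
  add_mem' := by
    rintro a b ⟨ha1, ha2, ka, hka⟩ ⟨hb1, hb2, kb, hkb⟩
    refine ⟨fun i => ?_, fun i j => ?_, ⟨ka + kb, ?_⟩⟩
    · obtain ⟨k, hk⟩ := ha1 i
      obtain ⟨l, hl⟩ := hb1 i
      exact ⟨k + l, by rw [Pi.add_apply, mul_add, hk, hl]; push_cast; ring⟩
    · obtain ⟨k, hk⟩ := ha2 i j
      obtain ⟨l, hl⟩ := hb2 i j
      refine ⟨k + l, ?_⟩
      rw [Pi.add_apply, Pi.add_apply]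
      push_cast
      rw [← hk, ← hl]
      ring
    · simp only [Pi.add_apply, Finset.sum_add_distrib, hka, hkb]
      push_cast
      ring
  zero_mem' := ⟨fun i => ⟨0, by simp⟩, fun i j => ⟨0, by simp⟩, ⟨0, by simp⟩⟩
  smul_mem' := by
    rintro c a ⟨ha1, ha2, ka, hka⟩
    refine ⟨fun i => ?_, fun i j => ?_, ⟨c * ka, ?_⟩⟩
    · obtain ⟨k, hk⟩ := ha1 i
      refine ⟨c * k, ?_⟩
      rw [Pi.smul_apply, zsmul_eq_mul]
      push_cast
      rw [mul_left_comm, hk]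
    · obtain ⟨k, hk⟩ := ha2 i j
      refine ⟨c * k, ?_⟩
      rw [Pi.smul_apply, Pi.smul_apply, zsmul_eq_mul, zsmul_eq_mul]
      push_cast
      rw [← mul_sub, hk]
    · simp only [Pi.smul_apply, zsmul_eq_mul, ← Finset.mul_sum, hka]
      push_cast
      ring

/-- The `ℚ`-linear map `(N ⊕ N) ⊗ ℚ → ℚ^16`, `(Nᵢ, 0) ↦ eᵢ + e_{i+8}`,
`(0, Nᵢ) ↦ eᵢ - e_{i+8}`. -/
def f16 : (Qv × Qv) →ₗ[ℚ] (Fin 16 → ℚ) where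
  toFun p := fun k =>
    if h : (k : ℕ) < 8 then p.1 ⟨(k : ℕ), h⟩ + p.2 ⟨(k : ℕ), h⟩
    else p.1 ⟨(k : ℕ) - 8, by have := k.isLt; omega⟩ - p.2 ⟨(k : ℕ) - 8, by have := k.isLt; omega⟩
  map_add' p q := by
    funext k
    by_cases h : (k : ℕ) < 8 <;> simp [h] <;> ring
  map_smul' c p := by
    funext k
    by_cases h : (k : ℕ) < 8 <;> simp [h] <;> ring

theorem mem_Nik_iff {y : Qv} :
    y ∈ Nik ↔ ∃ (c : ℤ) (a : Fin 8 → ℤ), ∀ i, y i = c / 2 + a i := by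
  constructor
  · intro hy
    refine Submodule.span_induction ?_ ⟨0, 0, by simp⟩ ?_ ?_ hy
    · rintro x (rfl | ⟨j, rfl⟩)
      · exact ⟨1, 0, by simp [Nhat]⟩
      · refine ⟨0, Pi.single j 1, fun i => ?_⟩
        by_cases h : i = j
        · subst h
          simp [Nvec]
        · simp [Nvec, h]
    · rintro x z - - ⟨c, a, h⟩ ⟨d, b, h'⟩
      refine ⟨c + d, a + b, fun i => ?_⟩
      simp only [Pi.add_apply, h, h']
      push_cast
      ring
    · rintro n x - ⟨c, a, h⟩
      refine ⟨n * c, n • a, fun i => ?_⟩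
      simp only [Pi.smul_apply, zsmul_eq_mul, h, smul_eq_mul]
      push_cast
      ring
  · rintro ⟨c, a, h⟩
    have hy : y = c • Nhat + ∑ i, a i • Nvec i := by
      funext j
      simp [h, Nhat, Nvec, Finset.sum_apply, Pi.single_apply, div_eq_mul_inv]
    rw [hy]
    exact add_mem (Nik.smul_mem _ (Submodule.subset_span (Set.mem_insert _ _)))
      (sum_mem fun i _ => Nik.smul_mem _ (Submodule.subset_span (Set.mem_insert_of_mem _ ⟨i, rfl⟩)))

theorem mem_Nik_of_two_mul_of_sub {y : Qv} (h₁ : ∀ i, ∃ k : ℤ, 2 * y i = k)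
    (h₂ : ∀ i j, ∃ k : ℤ, y i - y j = k) : y ∈ Nik := by
  obtain ⟨c, hc⟩ := h₁ 0
  choose a ha using fun i => h₂ i 0
  exact mem_Nik_iff.2 ⟨c, a, fun i => by rw [← ha, ← hc]; ring⟩

theorem f16_castAdd (p : Qv × Qv) (i : Fin 8) :
    f16 p (Fin.castAdd 8 i) = p.1 i + p.2 i := by
  simp [f16]

theorem f16_natAdd (p : Qv × Qv) (i : Fin 8) :
    f16 p (Fin.natAdd 8 i) = p.1 i - p.2 i := by
  simp [f16]

theorem sum_fin_sixteen (g : Fin 16 → ℚ) :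
    ∑ k, g k = ∑ i : Fin 8, g (Fin.castAdd 8 i) + ∑ i : Fin 8, g (Fin.natAdd 8 i) :=
  Fin.sum_univ_add (a := 8) (b := 8) g

theorem forall_fin_sixteen {P : Fin 16 → Prop} (h₁ : ∀ i : Fin 8, P (Fin.castAdd 8 i))
    (h₂ : ∀ i : Fin 8, P (Fin.natAdd 8 i)) (k : Fin 16) : P k :=
  Fin.addCases (m := 8) (n := 8) (motive := P) h₁ h₂ k

theorem f16_injective : Function.Injective f16 := by
  intro p q h
  have h₁ (i : Fin 8) : p.1 i + p.2 i = q.1 i + q.2 i := by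
    rw [← f16_castAdd, ← f16_castAdd, h]
  have h₂ (i : Fin 8) : p.1 i - p.2 i = q.1 i - q.2 i := by
    rw [← f16_natAdd, ← f16_natAdd, h]
  ext i
  · linarith [h₁ i, h₂ i]
  · linarith [h₁ i, h₂ i]

theorem f16_mem_Gamma16 {p : Qv × Qv} (hp : p ∈ NN) : f16 p ∈ Gamma16 := by
  obtain ⟨c, a, ha⟩ := mem_Nik_iff.1 hp.1
  obtain ⟨d, b, hb⟩ := mem_Nik_iff.1 hp.2
  have key (k : Fin 16) : ∃ m : ℤ, f16 p k = (c + d : ℚ) / 2 + m := by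
    induction k using forall_fin_sixteen with
    | h₁ i =>
      refine ⟨a i + b i, ?_⟩
      rw [f16_castAdd, ha, hb]
      push_cast
      ring
    | h₂ i =>
      refine ⟨a i - b i - d, ?_⟩
      rw [f16_natAdd, ha, hb]
      push_cast
      ring
  choose m hm using key
  refine ⟨fun k => ⟨c + d + 2 * m k, ?_⟩, fun k l => ⟨m k - m l, ?_⟩,
    ⟨4 * c + ∑ i, a i, ?_⟩⟩
  · rw [hm]
    push_cast
    ring
  · rw [hm, hm]
    push_cast
    ring
  · simp only [sum_fin_sixteen, f16_castAdd, f16_natAdd, ← Finset.sum_add_distrib]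
    have h (i : Fin 8) : p.1 i + p.2 i + (p.1 i - p.2 i) = c + 2 * a i := by
      rw [ha]
      ring
    simp only [h, Finset.sum_add_distrib, ← Finset.mul_sum]
    simp
    ring

theorem neg_sum_f16_mul_f16 (p q : Qv × Qv) : -(∑ k, f16 p k * f16 q k) = bNN p q := by
  simp only [bNN, bN, sum_fin_sixteen, f16_castAdd, f16_natAdd, ← Finset.sum_add_distrib,
    ← mul_add, Finset.mul_sum, ← Finset.sum_neg_distrib]
  exact Finset.sum_congr rfl fun i _ => by ring

/-- Lattice points of `Γ₁₆` have first half of their coordinates in the Nikulin lattice. -/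
theorem castAdd_mem_Nik {x : Fin 16 → ℚ} (hx : x ∈ Gamma16) :
    (fun i : Fin 8 => x (Fin.castAdd 8 i)) ∈ Nik :=
  mem_Nik_of_two_mul_of_sub (fun _ => hx.1 _) (fun _ _ => hx.2.1 _ _)

/-- `f16` restricts to an isometric embedding of `N ⊕ N` into `Γ₁₆(-1)`
(note `(N̂, 0) ↦ ½(e₁+⋯+e₁₆)` and `(0, N̂) ↦ ½(e₁+⋯+e₈-e₉-⋯-e₁₆)`), and the images of
`N ⊕ {0}` and `{0} ⊕ N` are primitive sublattices of `Γ₁₆(-1)`. -/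
theorem NN_embeds_in_Gamma16 :
    (∀ p ∈ NN, f16 p ∈ Gamma16) ∧
    Set.InjOn f16 (NN : Set (Qv × Qv)) ∧
    (∀ p ∈ NN, ∀ q ∈ NN, -(∑ i, f16 p i * f16 q i) = bNN p q) ∧
    (∀ x ∈ Gamma16, ∀ n : ℤ, n ≠ 0 →
      n • x ∈ Submodule.map (f16.restrictScalars ℤ) (Nik.prod ⊥) →
      x ∈ Submodule.map (f16.restrictScalars ℤ) (Nik.prod ⊥)) ∧
    (∀ x ∈ Gamma16, ∀ n : ℤ, n ≠ 0 →
      n • x ∈ Submodule.map (f16.restrictScalars ℤ) ((⊥ : Submodule ℤ Qv).prod Nik) →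
      x ∈ Submodule.map (f16.restrictScalars ℤ) ((⊥ : Submodule ℤ Qv).prod Nik)) := by
  refine ⟨fun p hp => f16_mem_Gamma16 hp, f16_injective.injOn,
    fun p _ q _ => neg_sum_f16_mul_f16 p q, fun x hx n hn h => ?_, fun x hx n hn h => ?_⟩
  all_goals
    have hn' : (n : ℚ) ≠ 0 := Int.cast_ne_zero.2 hn
    obtain ⟨⟨y, z⟩, ⟨hy, hz⟩, h⟩ := h
    have h₁ (i : Fin 8) : y i + z i = n * x (Fin.castAdd 8 i) := by
      rw [← f16_castAdd (y, z) i, ← zsmul_eq_mul]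
      exact congrFun h _
    have h₂ (i : Fin 8) : y i - z i = n * x (Fin.natAdd 8 i) := by
      rw [← f16_natAdd (y, z) i, ← zsmul_eq_mul]
      exact congrFun h _
  · obtain rfl : z = 0 := hz
    refine ⟨(fun i => x (Fin.castAdd 8 i), 0), ⟨castAdd_mem_Nik hx, rfl⟩,
      funext (forall_fin_sixteen (fun i => ?_) (fun i => ?_))⟩
    · exact (f16_castAdd _ i).trans (by simp)
    · have e : x (Fin.castAdd 8 i) = x (Fin.natAdd 8 i) := by
        apply mul_left_cancel₀ hn'
        rw [← h₁, ← h₂]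
        simp
      exact (f16_natAdd _ i).trans (by simpa using e)
  · obtain rfl : y = 0 := hy
    refine ⟨(0, fun i => x (Fin.castAdd 8 i)), ⟨rfl, castAdd_mem_Nik hx⟩,
      funext (forall_fin_sixteen (fun i => ?_) (fun i => ?_))⟩
    · exact (f16_castAdd _ i).trans (by simp)
    · have e : -x (Fin.castAdd 8 i) = x (Fin.natAdd 8 i) := by
        apply mul_left_cancel₀ hn'
        rw [mul_neg, ← h₁, ← h₂]
        simp
      exact (f16_natAdd _ i).trans (by simpa using e)
end

section
/- Every even unimodular overlattice L of N ⊕ N (inside (N ⊕ N) ⊗ ℚ) such that N ⊕ {0} is a primitive sublattice of L is isometric to Γ₁₆(−1). -/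
open Finset

/-- A rational number is an integer. -/
def IsInt (q : ℚ) : Prop := ∃ k : ℤ, q = k

theorem IsInt.intCast (k : ℤ) : IsInt (k : ℚ) := ⟨k, rfl⟩

theorem IsInt.add {a b : ℚ} : IsInt a → IsInt b → IsInt (a + b) := by
  rintro ⟨k, rfl⟩ ⟨l, rfl⟩
  exact ⟨k + l, by push_cast; ring⟩

theorem IsInt.sub {a b : ℚ} : IsInt a → IsInt b → IsInt (a - b) := by
  rintro ⟨k, rfl⟩ ⟨l, rfl⟩
  exact ⟨k - l, by push_cast; ring⟩

theorem IsInt.neg {a : ℚ} : IsInt a → IsInt (-a) := by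
  rintro ⟨k, rfl⟩
  exact ⟨-k, by push_cast; ring⟩

theorem IsInt.mul {a b : ℚ} : IsInt a → IsInt b → IsInt (a * b) := by
  rintro ⟨k, rfl⟩ ⟨l, rfl⟩
  exact ⟨k * l, by push_cast; ring⟩

theorem IsInt.sum {ι : Type*} (s : Finset ι) {f : ι → ℚ} (h : ∀ i ∈ s, IsInt (f i)) :
    IsInt (∑ i ∈ s, f i) := by
  choose! k hk using h
  exact ⟨∑ i ∈ s, k i, by push_cast; exact Finset.sum_congr rfl hk⟩

theorem Nvec_apply (i j : Fin 8) : Nvec i j = if j = i then 1 else 0 := by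
  simp [Nvec, Pi.single_apply]

theorem Nvec_mem_Nik (i : Fin 8) : Nvec i ∈ Nik :=
  Submodule.subset_span (Or.inr ⟨i, rfl⟩)

theorem Nhat_mem_Nik : Nhat ∈ Nik := Submodule.subset_span (Or.inl rfl)

theorem mem_Nik_iff_s10 (x : Qv) :
    x ∈ Nik ↔ (∀ i, IsInt (2 * x i)) ∧ ∀ i j, IsInt (x i - x j) := by
  constructor
  · intro hx
    induction hx using Submodule.span_induction with
    | mem x h =>
      rcases h with rfl | ⟨i, rfl⟩
      · exact ⟨fun i => ⟨1, by simp [Nhat]⟩, fun i j => ⟨0, by simp [Nhat]⟩⟩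
      · have h : ∀ j, IsInt (Nvec i j) := fun j => by
          rw [Nvec_apply]
          split_ifs
          · exact ⟨1, by simp⟩
          · exact ⟨0, by simp⟩
        exact ⟨fun j => IsInt.mul ⟨2, by simp⟩ (h j), fun j k => (h j).sub (h k)⟩
    | zero => exact ⟨fun i => ⟨0, by simp⟩, fun i j => ⟨0, by simp⟩⟩
    | add x y _ _ hx hy =>
      refine ⟨fun i => ?_, fun i j => ?_⟩
      · rw [Pi.add_apply, mul_add]
        exact (hx.1 i).add (hy.1 i)
      · rw [Pi.add_apply, Pi.add_apply, add_sub_add_comm]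
        exact (hx.2 i j).add (hy.2 i j)
    | smul c x _ hx =>
      refine ⟨fun i => ?_, fun i j => ?_⟩
      · rw [Pi.smul_apply, zsmul_eq_mul, mul_left_comm]
        exact (IsInt.intCast c).mul (hx.1 i)
      · rw [Pi.smul_apply, Pi.smul_apply, zsmul_eq_mul, zsmul_eq_mul, ← mul_sub]
        exact (IsInt.intCast c).mul (hx.2 i j)
  · rintro ⟨h2, hd⟩
    obtain ⟨k, hk⟩ := h2 0
    choose m hm using fun i => hd i 0
    have : x = k • Nhat + ∑ i, m i • Nvec i := by
      ext j
      have := hm j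
      simp only [Pi.add_apply, Pi.smul_apply, Finset.sum_apply]
      simp only [zsmul_eq_mul, Nvec_apply, Nhat, mul_ite, mul_one, mul_zero, Finset.sum_ite_eq,
        Finset.mem_univ, if_true]
      linarith
    rw [this]
    exact add_mem (Nik.smul_mem _ Nhat_mem_Nik)
      (sum_mem fun i _ => Nik.smul_mem _ (Nvec_mem_Nik i))

theorem bN_Nvec (x : Qv) (i : Fin 8) : bN x (Nvec i) = -2 * x i := by
  simp [bN, Nvec_apply]

theorem bN_Nhat (x : Qv) : bN x Nhat = -∑ i, x i := by
  simp only [bN, Nhat, ← Finset.sum_mul]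
  ring

theorem bN_zero_right (x : Qv) : bN x 0 = 0 := by simp [bN]

theorem bN_zero_left (x : Qv) : bN 0 x = 0 := by simp [bN]

/-- Membership in the dual lattice of the Nikulin lattice, in coordinates. -/
def IsDual (x : Qv) : Prop := (∀ i, IsInt (2 * x i)) ∧ IsInt (∑ i, x i)

theorem IsDual.isInt_bN {x n : Qv} (hx : IsDual x) (hn : n ∈ Nik) : IsInt (bN x n) := by
  obtain ⟨h2, hd⟩ := (mem_Nik_iff_s10 n).1 hn
  have : bN x n = -(∑ i, (2 * x i) * (n i - n 0)) - (∑ i, x i) * (2 * n 0) := by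
    simp only [bN, mul_sub, Finset.sum_sub_distrib, ← Finset.sum_mul, ← Finset.mul_sum, mul_assoc]
    ring
  rw [this]
  exact (IsInt.sum _ fun i _ => (hx.1 i).mul (hd i 0)).neg.sub (hx.2.mul (h2 0))

/-- `∑_{i ∈ T} Nᵢ / 2`. -/
def halfSum (T : Finset (Fin 8)) : Qv := fun k => if k ∈ T then 1 / 2 else 0

theorem bN_halfSum (S T : Finset (Fin 8)) : bN (halfSum S) (halfSum T) = -(#(S ∩ T) : ℚ) / 2 := by
  have : ∀ k, halfSum S k * halfSum T k = if k ∈ S ∩ T then 1 / 4 else 0 := fun k => by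
    by_cases h1 : k ∈ S <;> by_cases h2 : k ∈ T <;> simp [halfSum, h1, h2]
    norm_num
  simp only [bN, this, Finset.sum_ite_mem, Finset.univ_inter, Finset.sum_const, nsmul_eq_mul]
  ring

theorem halfSum_pair {c d : Fin 8} (h : c ≠ d) :
    halfSum {c, d} = (1 / 2 : ℚ) • (Nvec c + Nvec d) := by
  ext k
  simp only [halfSum, Finset.mem_insert, Finset.mem_singleton, Pi.smul_apply, Pi.add_apply,
    Nvec_apply, smul_eq_mul]
  by_cases h1 : k = c
  · subst h1
    simp [h]
  · by_cases h2 : k = d <;> simp [h1, h2]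
    simp [Ne.symm h]

theorem sum_halfSum (T : Finset (Fin 8)) : ∑ i, halfSum T i = (#T : ℚ) / 2 := by
  simp only [halfSum, Finset.sum_ite_mem, Finset.univ_inter, Finset.sum_const, nsmul_eq_mul]
  ring

theorem isDual_halfSum {T : Finset (Fin 8)} (hT : #T = 2) : IsDual (halfSum T) := by
  refine ⟨fun i => ?_, ⟨1, by rw [sum_halfSum, hT]; norm_num⟩⟩
  by_cases h : i ∈ T
  · exact ⟨1, by simp [halfSum, h]⟩
  · exact ⟨0, by simp [halfSum, h]⟩

theorem exists_halfSum_sub_mem_Nik {y : Qv} (hy : ∀ i, IsInt (2 * y i))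
    (hq : ∃ k : ℤ, -1 + bN y y = 2 * k) :
    ∃ T : Finset (Fin 8), #T = 2 ∧ halfSum T - y ∈ Nik := by
  choose m hm using hy
  obtain ⟨k, hk⟩ := hq
  set S : Finset (Fin 8) := Finset.univ.filter fun i => m i % 2 = 1 with hS
  have hsum : ∑ i, m i * m i = -4 * k - 2 := by
    have : (∑ i, (m i : ℚ) * m i) = -4 * k - 2 := by
      have h4 : (∑ i, (m i : ℚ) * m i) = 4 * ∑ i, y i * y i := by
        rw [Finset.mul_sum]
        exact Finset.sum_congr rfl fun i _ => by rw [← hm]; ring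
      rw [h4]
      simp only [bN] at hk
      linarith
    exact_mod_cast this
  have hcard : (#S : ℤ) = ∑ i, if m i % 2 = 1 then (1 : ℤ) else 0 := by
    rw [hS, Finset.card_filter]
    push_cast
    rfl
  have hdvd : (4 : ℤ) ∣ (∑ i, m i * m i) - #S := by
    rw [hcard, ← Finset.sum_sub_distrib]
    refine Finset.dvd_sum fun i _ => ?_
    rcases Int.even_or_odd' (m i) with ⟨t, ht | ht⟩
    · rw [if_neg (by omega), ht]
      exact ⟨t * t, by ring⟩
    · rw [if_pos (by omega), ht]
      exact ⟨t * t + t, by ring⟩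
  have hle : #S ≤ 8 := by simpa using Finset.card_le_univ S
  have hcases : #S = 2 ∨ #Sᶜ = 2 := by
    rw [Finset.card_compl, Fintype.card_fin]
    omega
  have hmem : ∀ i, i ∈ S ↔ m i % 2 = 1 := fun i => by simp [hS]
  have hint : ∀ i, IsInt (y i - halfSum S i) := fun i => by
    have := hm i
    by_cases h : i ∈ S
    · refine ⟨m i / 2, ?_⟩
      have h2 : ((m i : ℤ) : ℚ) = 2 * ((m i / 2 : ℤ) : ℚ) + 1 := by
        have := (hmem i).1 h
        exact_mod_cast (show m i = 2 * (m i / 2) + 1 by omega)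
      simp only [halfSum, h, if_true]
      linarith
    · refine ⟨m i / 2, ?_⟩
      have h2 : ((m i : ℤ) : ℚ) = 2 * ((m i / 2 : ℤ) : ℚ) := by
        have := mt (hmem i).2 h
        exact_mod_cast (show m i = 2 * (m i / 2) by omega)
      simp only [halfSum, h, if_false]
      linarith
  have hcompl : ∀ i, halfSum Sᶜ i = 1 / 2 - halfSum S i := fun i => by
    by_cases h : i ∈ S <;> simp [halfSum, h]
  have htwo : ∀ i, IsInt (2 * halfSum S i) := fun i => by
    by_cases h : i ∈ S
    · exact ⟨1, by simp [halfSum, h]⟩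
    · exact ⟨0, by simp [halfSum, h]⟩
  rcases hcases with h | h
  · refine ⟨S, h, (mem_Nik_iff_s10 _).2 ⟨fun i => ?_, fun i j => ?_⟩⟩
    · rw [Pi.sub_apply, mul_sub, hm]
      exact (htwo i).sub ⟨_, rfl⟩
    · have e : (halfSum S - y) i - (halfSum S - y) j
          = (y j - halfSum S j) - (y i - halfSum S i) := by
        simp only [Pi.sub_apply]
        ring
      rw [e]
      exact (hint j).sub (hint i)
  · refine ⟨Sᶜ, h, (mem_Nik_iff_s10 _).2 ⟨fun i => ?_, fun i j => ?_⟩⟩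
    · have e : 2 * (halfSum Sᶜ - y) i = (1 : ℤ) - 2 * halfSum S i - 2 * y i := by
        rw [Pi.sub_apply, hcompl]
        push_cast
        ring
      rw [e]
      exact ((IsInt.intCast 1).sub (htwo i)).sub ⟨_, hm i⟩
    · have e : (halfSum Sᶜ - y) i - (halfSum Sᶜ - y) j
          = (y j - halfSum S j) - (y i - halfSum S i) + 2 * halfSum S j - 2 * halfSum S i := by
        simp only [Pi.sub_apply, hcompl]
        ring
      rw [e]
      exact (((hint j).sub (hint i)).add (htwo j)).sub (htwo i)

theorem mem_of_pairwise_card_inter {α : Type*} [DecidableEq α] {A B C D : Finset α}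
    (hA : #A = 2) (hB : #B = 2) (hC : #C = 2) (hD : #D = 2)
    (hAB : #(A ∩ B) = 1) (hAC : #(A ∩ C) = 1) (hAD : #(A ∩ D) = 1) (hBC : #(B ∩ C) = 1)
    (hBD : #(B ∩ D) = 1) (hCD : #(C ∩ D) = 1) {c : α} (hcA : c ∈ A) (hcB : c ∈ B) : c ∈ C := by
  have key : ∀ {S : Finset α}, #S = 2 → ∀ {u}, u ∈ S → ∃ v, v ≠ u ∧ S = {u, v} := by
    intro S hS u hu
    obtain ⟨x, y, hxy, rfl⟩ := Finset.card_eq_two.1 hS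
    rcases Finset.mem_insert.1 hu with rfl | hu
    · exact ⟨y, hxy.symm, rfl⟩
    · rw [Finset.mem_singleton] at hu
      subst hu
      exact ⟨x, hxy, Finset.pair_comm _ _⟩
  have meet : ∀ {S T : Finset α}, #(S ∩ T) = 1 → ∃ v, v ∈ S ∧ v ∈ T := fun h => by
    obtain ⟨v, hv⟩ := Finset.card_pos.1 (h ▸ Nat.one_pos)
    exact ⟨v, Finset.mem_inter.1 hv⟩
  have ne : ∀ {S T : Finset α}, #(S ∩ T) = 1 → #S = 2 → S ≠ T := by
    rintro S T h h2 rfl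
    rw [Finset.inter_self] at h
    omega
  by_contra hcC
  obtain ⟨a, hac, rfl⟩ := key hA hcA
  obtain ⟨b, hbc, rfl⟩ := key hB hcB
  have hab : a ≠ b := fun h => ne hAB hA (by rw [h])
  have haC : a ∈ C := by
    obtain ⟨v, h1, h2⟩ := meet hAC
    rcases Finset.mem_insert.1 h1 with rfl | h1
    · exact absurd h2 hcC
    · rwa [← Finset.mem_singleton.1 h1]
  have hbC : b ∈ C := by
    obtain ⟨v, h1, h2⟩ := meet hBC
    rcases Finset.mem_insert.1 h1 with rfl | h1
    · exact absurd h2 hcC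
    · rwa [← Finset.mem_singleton.1 h1]
  have hCab : ({a, b} : Finset α) = C := Finset.eq_of_subset_of_card_le
    (by simp [Finset.insert_subset_iff, haC, hbC]) (by rw [hC, Finset.card_pair hab])
  subst hCab
  have two : ∀ {x y : α}, x ≠ y → x ∈ D → y ∈ D → ({x, y} : Finset α) = D := fun hxy hx hy =>
    Finset.eq_of_subset_of_card_le (by simp [Finset.insert_subset_iff, hx, hy])
      (by rw [hD, Finset.card_pair hxy])
  obtain ⟨u, hu, huD⟩ := meet hAD
  obtain ⟨v, hv, hvD⟩ := meet hBD
  obtain ⟨w, hw, hwD⟩ := meet hCD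
  simp only [Finset.mem_insert, Finset.mem_singleton] at hu hv hw
  have h1 : ¬(c ∈ D ∧ a ∈ D) := fun h => ne hAD hA (two hac.symm h.1 h.2)
  have h2 : ¬(c ∈ D ∧ b ∈ D) := fun h => ne hBD hB (two hbc.symm h.1 h.2)
  have h3 : ¬(a ∈ D ∧ b ∈ D) := fun h => ne hCD hC (two hab h.1 h.2)
  grind

/-- Seven pairs in which any two meet in exactly one point form a star. -/
theorem exists_perm_of_pairwise_card_inter (T : Fin 7 → Finset (Fin 8)) (hT : ∀ i, #(T i) = 2)
    (hTT : ∀ i j, i ≠ j → #(T i ∩ T j) = 1) :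
    ∃ σ : Equiv.Perm (Fin 8), ∀ i, T i = {σ 0, σ i.succ} := by
  obtain ⟨c, hc⟩ := Finset.card_pos.1 (hTT 0 1 (by decide) ▸ Nat.one_pos)
  obtain ⟨hc0, hc1⟩ := Finset.mem_inter.1 hc
  have hcT : ∀ k, c ∈ T k := by
    intro k
    by_cases h0 : k = 0
    · rwa [h0]
    by_cases h1 : k = 1
    · rwa [h1]
    obtain ⟨j, hj0, hj1, hjk⟩ : ∃ j : Fin 7, 0 ≠ j ∧ 1 ≠ j ∧ k ≠ j := by
      revert k
      decide
    exact mem_of_pairwise_card_inter (hT 0) (hT 1) (hT k) (hT j) (hTT _ _ (by decide))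
      (hTT _ _ (Ne.symm h0)) (hTT _ _ hj0) (hTT _ _ (Ne.symm h1)) (hTT _ _ hj1) (hTT _ _ hjk)
      hc0 hc1
  have hd : ∀ i, ∃ d, d ≠ c ∧ T i = {c, d} := fun i => by
    obtain ⟨x, y, hxy, h⟩ := Finset.card_eq_two.1 (hT i)
    have := hcT i
    rw [h, Finset.mem_insert, Finset.mem_singleton] at this
    rcases this with rfl | rfl
    · exact ⟨y, hxy.symm, h⟩
    · exact ⟨x, hxy, by rw [h, Finset.pair_comm]⟩
  choose d hdc hTd using hd
  have hinj : Function.Injective (Fin.cons c d : Fin 8 → Fin 8) := by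
    rw [Fin.cons_injective_iff]
    refine ⟨fun ⟨i, hi⟩ => hdc i hi, fun i j hij => ?_⟩
    by_contra hne
    have h := hTT i j hne
    rw [hTd i, hTd j, hij, Finset.inter_self, Finset.card_pair (hdc j).symm] at h
    omega
  refine ⟨Equiv.ofBijective _ (Finite.injective_iff_bijective.1 hinj), fun i => ?_⟩
  simpa using hTd i

section Overlattice

variable {L : Submodule ℤ (Qv × Qv)}

theorem isDual_of_mem (hover : NN ≤ L) (hint : ∀ x ∈ L, ∀ y ∈ L, ∃ k : ℤ, bNN x y = k)
    {x : Qv × Qv} (hx : x ∈ L) : IsDual x.1 ∧ IsDual x.2 := by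
  have h1 : ∀ n ∈ Nik, IsInt (bN x.1 n) := fun n hn => by
    simpa [IsInt, bNN, bN_zero_right] using hint x hx (n, 0) (hover ⟨hn, Nik.zero_mem⟩)
  have h2 : ∀ n ∈ Nik, IsInt (bN x.2 n) := fun n hn => by
    simpa [IsInt, bNN, bN_zero_right] using hint x hx (0, n) (hover ⟨Nik.zero_mem, hn⟩)
  have key : ∀ y : Qv, (∀ n ∈ Nik, IsInt (bN y n)) → IsDual y := fun y hy => by
    refine ⟨fun i => ?_, ?_⟩
    · simpa [bN_Nvec] using (hy _ (Nvec_mem_Nik i)).neg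
    · simpa [bN_Nhat] using (hy _ Nhat_mem_Nik).neg
  exact ⟨key _ h1, key _ h2⟩

/-- `bN x` as a linear map. -/
def bNHom (x : Qv) : Qv →ₗ[ℤ] ℚ where
  toFun := bN x
  map_add' y z := by simp only [bN, Pi.add_apply, mul_add, Finset.sum_add_distrib]
  map_smul' c y := by
    simp only [bN, Pi.smul_apply, zsmul_eq_mul, mul_left_comm _ (c : ℚ), ← Finset.mul_sum,
      eq_intCast, Int.cast_id]

theorem finite_overlattice (hover : NN ≤ L) (hfin : Finite (L ⧸ NN.comap L.subtype)) :
    Module.Finite ℤ L := by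
  have hNik : Nik.FG := Submodule.fg_span ((Set.finite_range Nvec).insert Nhat)
  have : Module.Finite ℤ NN := Module.Finite.iff_fg.2 (hNik.prod hNik)
  have : Module.Finite ℤ (NN.comap L.subtype) :=
    Module.Finite.equiv (Submodule.comapSubtypeEquivOfLe hover).symm
  exact Module.Finite.of_submodule_quotient (NN.comap L.subtype)

theorem exists_mem_of_isDual (hover : NN ≤ L)
    (hfin : Finite (L ⧸ NN.comap L.subtype))
    (hint : ∀ x ∈ L, ∀ y ∈ L, ∃ k : ℤ, bNN x y = k)
    (hunimod : {x : Qv × Qv | ∀ m ∈ L, ∃ k : ℤ, bNN x m = k} = (L : Set (Qv × Qv)))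
    (hprim : ∀ x ∈ L, ∀ n : ℤ, n ≠ 0 → n • x ∈ Nik.prod ⊥ → x ∈ Nik.prod ⊥)
    {x : Qv} (hx : IsDual x) : ∃ y, (x, y) ∈ L := by
  set K : Submodule ℤ L := (Nik.prod ⊥).comap L.subtype
  have : Module.Finite ℤ L := finite_overlattice hover hfin
  have : Module.IsTorsionFree ℤ (L ⧸ K) := by
    refine .of_smul_eq_zero fun n q hq => ?_
    obtain ⟨l, rfl⟩ := K.mkQ_surjective q
    rw [← map_smul, Submodule.mkQ_apply, Submodule.Quotient.mk_eq_zero] at hq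
    rw [or_iff_not_imp_left, Submodule.mkQ_apply, Submodule.Quotient.mk_eq_zero]
    exact fun hn => hprim l l.2 n hn hq
  obtain ⟨s, hs⟩ := Module.projective_lifting_property K.mkQ LinearMap.id K.mkQ_surjective
  let r : L →ₗ[ℤ] L := LinearMap.id - s ∘ₗ K.mkQ
  have hr : ∀ l, r l ∈ K := fun l => by
    rw [← Submodule.Quotient.mk_eq_zero, ← Submodule.mkQ_apply]
    have := LinearMap.congr_fun hs (K.mkQ l)
    simp only [LinearMap.comp_apply, LinearMap.id_apply] at this
    simp only [r, LinearMap.sub_apply, LinearMap.comp_apply, LinearMap.id_apply, map_sub, this,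
      sub_self]
  have hrK : ∀ l ∈ K, r l = l := fun l hl => by
    have : K.mkQ l = 0 := by simpa using hl
    simp [r, -Submodule.mkQ_apply, this]
  let g : L →ₗ[ℤ] ℚ := bNHom x ∘ₗ LinearMap.fst ℤ Qv Qv ∘ₗ L.subtype ∘ₗ r
  have hg : ∀ l, g l = bN x (r l : Qv × Qv).1 := fun l => rfl
  have hmem1 : ∀ i, (Nvec i, (0 : Qv)) ∈ L := fun i => hover ⟨Nvec_mem_Nik i, Nik.zero_mem⟩
  have hmem2 : ∀ i, ((0 : Qv), Nvec i) ∈ L := fun i => hover ⟨Nik.zero_mem, Nvec_mem_Nik i⟩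
  let z : Qv × Qv := (fun i => g ⟨_, hmem1 i⟩ / (-2), fun i => g ⟨_, hmem2 i⟩ / (-2))
  have hz : z ∈ L := by
    rw [← SetLike.mem_coe, ← hunimod]
    intro l hl
    obtain ⟨hl1, hl2⟩ := isDual_of_mem hover hint hl
    choose k hk using hl1.1
    choose m hm using hl2.1
    have hdouble : (2 : ℤ) • (⟨l, hl⟩ : L)
        = ∑ i, k i • (⟨_, hmem1 i⟩ : L) + ∑ i, m i • (⟨_, hmem2 i⟩ : L) := by
      ext j
      · simp [Prod.fst_sum, Finset.sum_apply, Nvec_apply, ← hk]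
      · simp [Prod.snd_sum, Finset.sum_apply, Nvec_apply, ← hm]
    have hg2 := congrArg g hdouble
    simp only [map_add, map_sum, map_zsmul, zsmul_eq_mul, ← hk, ← hm] at hg2
    have hval : bNN z l = g ⟨l, hl⟩ := by
      have h1 : bN z.1 l.1 = (∑ i, 2 * l.1 i * g ⟨_, hmem1 i⟩) / 2 := by
        rw [bN, Finset.mul_sum, Finset.sum_div]
        exact Finset.sum_congr rfl fun i _ => by simp only [z]; ring
      have h2 : bN z.2 l.2 = (∑ i, 2 * l.2 i * g ⟨_, hmem2 i⟩) / 2 := by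
        rw [bN, Finset.mul_sum, Finset.sum_div]
        exact Finset.sum_congr rfl fun i _ => by simp only [z]; ring
      rw [bNN, h1, h2]
      push_cast at hg2
      linarith
    rw [hval, hg]
    exact hx.isInt_bN (hr _).1
  refine ⟨z.2, ?_⟩
  have hz1 : z.1 = x := by
    ext i
    have : g ⟨_, hmem1 i⟩ = -2 * x i := by
      have hK : (⟨_, hmem1 i⟩ : L) ∈ K :=
        show (Nvec i, (0 : Qv)) ∈ Nik.prod ⊥ from ⟨Nvec_mem_Nik i, Submodule.zero_mem _⟩
      rw [hg, hrK _ hK, bN_Nvec]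
    simp only [z, this]
    ring
  rw [← hz1]
  exact hz

/-- The lattice glued from `N` and `N` along the permutation `σ` of the coordinates. -/
def IsGlued (σ : Equiv.Perm (Fin 8)) (p : Qv × Qv) : Prop :=
  IsDual p.1 ∧ p.1 - p.2 ∘ σ ∈ Nik

theorem exists_perm_halfSum_mem (hover : NN ≤ L)
    (hfin : Finite (L ⧸ NN.comap L.subtype))
    (hint : ∀ x ∈ L, ∀ y ∈ L, ∃ k : ℤ, bNN x y = k)
    (heven : ∀ x ∈ L, ∃ k : ℤ, bNN x x = 2 * k)
    (hunimod : {x : Qv × Qv | ∀ m ∈ L, ∃ k : ℤ, bNN x m = k} = (L : Set (Qv × Qv)))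
    (hprim : ∀ x ∈ L, ∀ n : ℤ, n ≠ 0 → n • x ∈ Nik.prod ⊥ → x ∈ Nik.prod ⊥) :
    ∃ σ : Equiv.Perm (Fin 8), ∀ i,
      ((1 / 2 : ℚ) • (Nvec 0 + Nvec i), (1 / 2 : ℚ) • (Nvec (σ 0) + Nvec (σ i))) ∈ L := by
  have hcard : ∀ i : Fin 7, #({0, i.succ} : Finset (Fin 8)) = 2 := fun i =>
    Finset.card_pair (Fin.succ_ne_zero i).symm
  have hex : ∀ i : Fin 7, ∃ T : Finset (Fin 8), #T = 2 ∧
      (halfSum {0, i.succ}, halfSum T) ∈ L := by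
    intro i
    obtain ⟨y, hy⟩ :=
      exists_mem_of_isDual hover hfin hint hunimod hprim (isDual_halfSum (hcard i))
    have hq := heven _ hy
    simp only [bNN, bN_halfSum, Finset.inter_self, hcard i] at hq
    obtain ⟨T, hT, hTy⟩ := exists_halfSum_sub_mem_Nik (isDual_of_mem hover hint hy).2.1
      (by simpa using hq)
    refine ⟨T, hT, ?_⟩
    have := L.add_mem hy (hover (show ((0 : Qv), halfSum T - y) ∈ NN from ⟨Nik.zero_mem, hTy⟩))
    simpa using this
  choose T hT hTL using hex
  obtain ⟨σ, hσ⟩ := exists_perm_of_pairwise_card_inter T hT (fun i j hij => by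
    obtain ⟨k, hk⟩ := hint _ (hTL i) _ (hTL j)
    have h1 : ({0, i.succ} ∩ {0, j.succ} : Finset (Fin 8)) = {0} := by
      ext a
      simp only [Finset.mem_inter, Finset.mem_insert, Finset.mem_singleton]
      have := (Fin.succ_injective 7).ne hij
      grind
    simp only [bNN, bN_halfSum, h1, Finset.card_singleton] at hk
    have hk' : (-1 : ℚ) - (#(T i ∩ T j) : ℤ) = 2 * (k : ℤ) := by
      push_cast
      push_cast at hk
      linarith
    have hk'' : (-1 : ℤ) - (#(T i ∩ T j) : ℤ) = 2 * k := by exact_mod_cast hk'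
    have hle : #(T i ∩ T j) ≤ 2 := hT i ▸ Finset.card_le_card Finset.inter_subset_left
    omega)
  refine ⟨σ, fun i => ?_⟩
  induction i using Fin.cases with
  | zero =>
    have h : ∀ v : Qv, (1 / 2 : ℚ) • (v + v) = v := fun v => by
      rw [← two_smul ℚ v, smul_smul]
      norm_num
    rw [h, h]
    exact hover ⟨Nvec_mem_Nik _, Nvec_mem_Nik _⟩
  | succ i =>
    have := hTL i
    rwa [hσ i, halfSum_pair (Fin.succ_ne_zero i).symm,
      halfSum_pair (σ.injective.ne (Fin.succ_ne_zero i).symm)] at this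

theorem exists_perm_mem_iff_isGlued (hover : NN ≤ L)
    (hfin : Finite (L ⧸ NN.comap L.subtype))
    (hint : ∀ x ∈ L, ∀ y ∈ L, ∃ k : ℤ, bNN x y = k)
    (heven : ∀ x ∈ L, ∃ k : ℤ, bNN x x = 2 * k)
    (hunimod : {x : Qv × Qv | ∀ m ∈ L, ∃ k : ℤ, bNN x m = k} = (L : Set (Qv × Qv)))
    (hprim : ∀ x ∈ L, ∀ n : ℤ, n ≠ 0 → n • x ∈ Nik.prod ⊥ → x ∈ Nik.prod ⊥) :
    ∃ σ : Equiv.Perm (Fin 8), ∀ p, p ∈ L ↔ IsGlued σ p := by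
  obtain ⟨σ, hσ⟩ := exists_perm_halfSum_mem hover hfin hint heven hunimod hprim
  have hperm : ∀ w : Qv, w ∘ σ ∈ Nik ↔ w ∈ Nik := fun w => by
    simp only [mem_Nik_iff_s10, Function.comp_apply]
    refine and_congr (σ.forall_congr_left.trans (by simp)) ?_
    constructor
    · intro h i j
      simpa using h (σ.symm i) (σ.symm j)
    · exact fun h i j => h _ _
  have hdiag : ∀ x : Qv, IsDual x → (x, x ∘ σ.symm) ∈ L := by
    rintro x ⟨h2, k, hk⟩
    choose m hm using h2
    have h0 := hover (show (Nvec 0, Nvec (σ 0)) ∈ NN from ⟨Nvec_mem_Nik _, Nvec_mem_Nik _⟩)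
    have : (x, x ∘ σ.symm) = ∑ i, m i • ((1 / 2 : ℚ) • (Nvec 0 + Nvec i),
        (1 / 2 : ℚ) • (Nvec (σ 0) + Nvec (σ i))) - k • (Nvec 0, Nvec (σ 0)) := by
      ext j
      · simp only [Prod.fst_sub, Prod.fst_sum, Prod.smul_fst, Pi.sub_apply, Finset.sum_apply,
          Pi.smul_apply, Pi.add_apply]
        simp only [zsmul_eq_mul, smul_eq_mul, ← hm, ← hk]
        have e : ∀ i, 2 * x i * (1 / 2 * (Nvec 0 j + Nvec i j))
            = x i * Nvec 0 j + x i * Nvec i j := fun i => by ring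
        simp only [e, Finset.sum_add_distrib, ← Finset.sum_mul]
        simp [Nvec_apply]
      · simp only [Prod.snd_sub, Prod.snd_sum, Prod.smul_snd, Pi.sub_apply, Finset.sum_apply,
          Pi.smul_apply, Pi.add_apply]
        simp only [zsmul_eq_mul, smul_eq_mul, ← hm, ← hk]
        have e : ∀ i, 2 * x i * (1 / 2 * (Nvec (σ 0) j + Nvec (σ i) j))
            = x i * Nvec (σ 0) j + x i * Nvec (σ i) j := fun i => by ring
        simp only [e, Finset.sum_add_distrib, ← Finset.sum_mul]
        simp [Nvec_apply, ← Equiv.symm_apply_eq]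
    rw [this]
    exact L.sub_mem (sum_mem fun i _ => L.smul_mem _ (hσ i)) (L.smul_mem _ h0)
  refine ⟨σ, fun p => ⟨fun hp => ?_, fun hp => ?_⟩⟩
  · have hd := (isDual_of_mem hover hint hp).1
    refine ⟨hd, ?_⟩
    have hw := L.sub_mem (hdiag _ hd) hp
    have e : p.1 - p.2 ∘ σ = (p.1 ∘ σ.symm - p.2) ∘ σ := by
      ext i
      simp
    rw [e, hperm]
    rw [show ((p.1, p.1 ∘ σ.symm) - p : Qv × Qv) = (0, p.1 ∘ σ.symm - p.2) by
      ext <;> simp] at hw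
    generalize p.1 ∘ σ.symm - p.2 = w at hw
    have h2 := (isDual_of_mem hover hint hw).2.1
    have hs : ∀ j, IsInt (w (σ 0) + w j) := fun j => by
      have h := hint _ hw _ (hσ (σ.symm j))
      have e2 : bN w ((1 / 2 : ℚ) • (Nvec (σ 0) + Nvec j)) = -(w (σ 0) + w j) := by
        simp only [bN, Pi.smul_apply, Pi.add_apply, smul_eq_mul, Nvec_apply]
        simp [mul_add, Finset.sum_add_distrib]
        ring
      simp only [bNN, bN_zero_left, zero_add, Equiv.apply_symm_apply, e2] at h
      simpa using IsInt.neg h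
    refine (mem_Nik_iff_s10 w).2 ⟨h2, fun i j => ?_⟩
    simpa using (hs i).sub (hs j)
  · obtain ⟨hd, hn⟩ := hp
    have hn' : p.2 - p.1 ∘ σ.symm ∈ Nik := by
      rw [← hperm]
      have e : (p.2 - p.1 ∘ σ.symm) ∘ σ = -(p.1 - p.2 ∘ σ) := by
        ext i
        simp
      rw [e]
      exact Nik.neg_mem hn
    have := L.add_mem (hdiag _ hd)
      (hover (show ((0 : Qv), p.2 - p.1 ∘ σ.symm) ∈ NN from ⟨Nik.zero_mem, hn'⟩))
    simpa using this

end Overlattice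

/-- The similarity `(x, y) ↦ (x - σ y, x + σ y)` from `ℚ^8 × ℚ^8` to `ℚ^16`. -/
def rotateEquiv (σ : Equiv.Perm (Fin 8)) : (Qv × Qv) ≃ₗ[ℤ] (Fin (8 + 8) → ℚ) where
  toFun p := Fin.append (p.1 - p.2 ∘ σ) (p.1 + p.2 ∘ σ)
  invFun z := (fun i => (z (Fin.castAdd 8 i) + z (Fin.natAdd 8 i)) / 2,
    fun i => (z (Fin.natAdd 8 (σ.symm i)) - z (Fin.castAdd 8 (σ.symm i))) / 2)
  map_add' p q := by
    ext i
    refine Fin.addCases (fun i => ?_) (fun i => ?_) i <;> simp [-Fin.natAdd_eq_addNat] <;> ring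
  map_smul' c p := by
    ext i
    refine Fin.addCases (fun i => ?_) (fun i => ?_) i <;> simp [-Fin.natAdd_eq_addNat] <;> ring
  left_inv p := by
    ext i <;> simp [-Fin.natAdd_eq_addNat]
  right_inv z := by
    ext i
    refine Fin.addCases (fun i => ?_) (fun i => ?_) i <;> simp [-Fin.natAdd_eq_addNat] <;> ring

theorem rotateEquiv_castAdd (σ : Equiv.Perm (Fin 8)) (p : Qv × Qv) (i : Fin 8) :
    rotateEquiv σ p (Fin.castAdd 8 i) = p.1 i - p.2 (σ i) := by
  simp [rotateEquiv]

theorem rotateEquiv_natAdd (σ : Equiv.Perm (Fin 8)) (p : Qv × Qv) (i : Fin 8) :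
    rotateEquiv σ p (Fin.natAdd 8 i) = p.1 i + p.2 (σ i) := by
  simp [rotateEquiv, -Fin.natAdd_eq_addNat]

theorem sum_rotateEquiv (σ : Equiv.Perm (Fin 8)) (p : Qv × Qv) :
    ∑ i, rotateEquiv σ p i = 2 * ∑ i, p.1 i := by
  rw [Fin.sum_univ_add]
  simp only [rotateEquiv_castAdd, rotateEquiv_natAdd, Finset.sum_add_distrib,
    Finset.sum_sub_distrib]
  ring

theorem sum_rotateEquiv_mul (σ : Equiv.Perm (Fin 8)) (p q : Qv × Qv) :
    -∑ i, rotateEquiv σ p i * rotateEquiv σ q i = bNN p q := by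
  rw [Fin.sum_univ_add]
  have h : ∑ i, p.2 i * q.2 i = ∑ i, p.2 (σ i) * q.2 (σ i) :=
    (Equiv.sum_comp σ fun i => p.2 i * q.2 i).symm
  rw [bNN, bN, bN, h, ← Finset.sum_add_distrib, ← mul_add, ← Finset.sum_add_distrib,
    Finset.mul_sum, ← Finset.sum_neg_distrib]
  refine Finset.sum_congr rfl fun i _ => ?_
  rw [rotateEquiv_castAdd, rotateEquiv_natAdd, rotateEquiv_castAdd, rotateEquiv_natAdd]
  ring

theorem rotateEquiv_mem_Gamma16_iff (σ : Equiv.Perm (Fin 8)) (p : Qv × Qv) :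
    rotateEquiv σ p ∈ Gamma16 ↔ IsGlued σ p := by
  have hΓ : rotateEquiv σ p ∈ Gamma16 ↔ (∀ i, IsInt (2 * rotateEquiv σ p i)) ∧
      (∀ i j, IsInt (rotateEquiv σ p i - rotateEquiv σ p j)) ∧
      ∃ k : ℤ, ∑ i, rotateEquiv σ p i = 2 * k := Iff.rfl
  rw [hΓ, sum_rotateEquiv, IsGlued, IsDual, mem_Nik_iff_s10]
  simp only [Pi.sub_apply, Function.comp_apply]
  constructor
  · rintro ⟨h2, hd, k, hk⟩
    refine ⟨⟨fun i => ?_, k, by linarith⟩, fun i => ?_, fun i j => ?_⟩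
    · have h := (hd (Fin.natAdd 8 i) (Fin.castAdd 8 i)).add (h2 (Fin.castAdd 8 i))
      rw [rotateEquiv_castAdd, rotateEquiv_natAdd] at h
      convert h using 1
      ring
    · have h := h2 (Fin.castAdd 8 i)
      rwa [rotateEquiv_castAdd] at h
    · have h := hd (Fin.castAdd 8 i) (Fin.castAdd 8 j)
      rwa [rotateEquiv_castAdd, rotateEquiv_castAdd] at h
  · rintro ⟨⟨h2, k, hk⟩, hn2, hnd⟩
    have hleft : ∀ i, IsInt (rotateEquiv σ p i - (p.1 0 - p.2 (σ 0))) := fun i => by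
      refine Fin.addCases (fun i => ?_) (fun i => ?_) i
      · rw [rotateEquiv_castAdd]
        exact hnd i 0
      · rw [rotateEquiv_natAdd]
        convert ((h2 i).sub (hn2 i)).add (hnd i 0) using 1
        ring
    refine ⟨fun i => ?_, fun i j => ?_, k, by rw [hk]⟩
    · convert (((IsInt.intCast 2).mul (hleft i)).add (hn2 0)) using 1
      push_cast
      ring
    · convert (hleft i).sub (hleft j) using 1
      ring

/-- every even unimodular overlattice `L` of `N ⊕ N` in which `N ⊕ {0}` is
primitive is isometric to `Γ₁₆(-1)`. -/
theorem even_unimodular_overlattice_of_NN_isometric_Gamma16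
    (L : Submodule ℤ (Qv × Qv))
    (hover : NN ≤ L)
    (hfin : Finite (L ⧸ NN.comap L.subtype))
    (hint : ∀ x ∈ L, ∀ y ∈ L, ∃ k : ℤ, bNN x y = k)
    (heven : ∀ x ∈ L, ∃ k : ℤ, bNN x x = 2 * k)
    (hunimod : {x : Qv × Qv | ∀ m ∈ L, ∃ k : ℤ, bNN x m = k} = (L : Set (Qv × Qv)))
    (hprim : ∀ x ∈ L, ∀ n : ℤ, n ≠ 0 → n • x ∈ Nik.prod ⊥ → x ∈ Nik.prod ⊥) :
    ∃ e : L ≃ₗ[ℤ] Gamma16,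
      ∀ x y : L,
        -(∑ i, ((e x : Fin 16 → ℚ) i * (e y : Fin 16 → ℚ) i)) =
          bNN (x : Qv × Qv) (y : Qv × Qv) := by
  obtain ⟨σ, hσ⟩ := exists_perm_mem_iff_isGlued hover hfin hint heven hunimod hprim
  have hmap : L.map (rotateEquiv σ : (Qv × Qv) →ₗ[ℤ] (Fin (8 + 8) → ℚ)) = Gamma16 := by
    ext z
    obtain ⟨p, rfl⟩ := (rotateEquiv σ).surjective z
    rw [rotateEquiv_mem_Gamma16_iff, ← hσ]
    simp
  exact ⟨(rotateEquiv σ).ofSubmodules L Gamma16 hmap,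
    fun x y => sum_rotateEquiv_mul σ (x : Qv × Qv) (y : Qv × Qv)⟩
end

section
/- Let d be a positive odd integer and let Λ_{2d} = ℤL ⊕ E8(−2), where L·L = 2d and L is orthogonal to E8(−2). Then there is no even overlattice Λ̃ of Λ_{2d} with [Λ̃ : Λ_{2d}] = 2 in which E8(−2) is a primitive sublattice. (Consequently, an even lattice of rank 9 containing E8(−2) as a primitive sublattice with a generator L of E8(−2)^⊥ satisfying L² ≡ 2 mod 4 must equal ℤL ⊕ E8(−2).) -/
open Matrix Finset

/-- The ambient space `Λ_{2d} ⊗ ℚ = ℚL ⊕ (E8(-2) ⊗ ℚ)`. -/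
abbrev Amb : Type := ℚ × (Fin 8 → ℚ)

/-- The E8 Cartan matrix over `ℚ`. -/
def E8Q : Matrix (Fin 8) (Fin 8) ℚ := CartanMatrix.E₈.map fun k => (k : ℚ)

/-- The bilinear form of `ℤL ⊕ E8(-2)` (extended to the ambient `ℚ`-space), where
`L·L = 2d` and the second factor carries `-2` times the E8 Cartan pairing. -/
def bL (d : ℤ) (p q : Amb) : ℚ := 2 * d * p.1 * q.1 + (-2) * (p.2 ⬝ᵥ (E8Q *ᵥ q.2))

/-- The integers inside `ℚ` (the coefficients of `L`). -/
def Zsub : Submodule ℤ ℚ := Submodule.span ℤ ({1} : Set ℚ)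

/-- The integral points of `E8(-2) ⊗ ℚ`. -/
def ZV : Submodule ℤ (Fin 8 → ℚ) :=
  Submodule.span ℤ (Set.range fun i => Pi.single i (1 : ℚ))

/-- The lattice `Λ_{2d} = ℤL ⊕ E8(-2)`. -/
def Lambda : Submodule ℤ Amb := Zsub.prod ZV

/-- The sublattice `ℤL`. -/
def Lline : Submodule ℤ Amb := Zsub.prod ⊥

/-- The sublattice `E8(-2)`. -/
def Esub : Submodule ℤ Amb := (⊥ : Submodule ℤ ℚ).prod ZV

/-- The value `v·v` in `E8(-2)` for an integral vector `v`. -/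
def q8 (v : Fin 8 → ℤ) : ℤ := -2 * (v ⬝ᵥ (CartanMatrix.E₈ *ᵥ v))

/-- The E8 form is even on integral vectors. -/
theorem even_dotProduct_E8_mulVec (v : Fin 8 → ℤ) :
    Even (v ⬝ᵥ (CartanMatrix.E₈ *ᵥ v)) := by
  refine ⟨v 0 ^ 2 + v 1 ^ 2 + v 2 ^ 2 + v 3 ^ 2 + v 4 ^ 2 + v 5 ^ 2 + v 6 ^ 2 + v 7 ^ 2
    - v 0 * v 2 - v 1 * v 3 - v 2 * v 3 - v 3 * v 4 - v 4 * v 5 - v 5 * v 6 - v 6 * v 7, ?_⟩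
  simp [CartanMatrix.E₈, Matrix.mulVec, dotProduct, Fin.sum_univ_eight]
  ring

theorem mem_Zsub_iff {x : ℚ} : x ∈ Zsub ↔ ∃ n : ℤ, (n : ℚ) = x := by
  simp [Zsub, Submodule.mem_span_singleton]

theorem mem_ZV_iff {x : Fin 8 → ℚ} :
    x ∈ ZV ↔ ∃ v : Fin 8 → ℤ, (fun i => (v i : ℚ)) = x := by
  rw [ZV, Submodule.mem_span_range_iff_exists_fun]
  refine exists_congr fun v => ?_
  have : ∑ i, v i • (Pi.single i (1 : ℚ) : Fin 8 → ℚ) = fun i => (v i : ℚ) := by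
    ext j
    simp [Finset.sum_apply, Pi.single_apply]
  rw [this]

theorem dotProduct_E8Q_mulVec_intCast (v : Fin 8 → ℤ) :
    (fun i => (v i : ℚ)) ⬝ᵥ (E8Q *ᵥ fun i => (v i : ℚ)) =
      ((v ⬝ᵥ (CartanMatrix.E₈ *ᵥ v) : ℤ) : ℚ) := by
  simp [E8Q, Matrix.mulVec, dotProduct]

theorem exists_mem_notMem_two_smul_mem {M : Type*} [AddCommGroup M] {S T : Submodule ℤ M}
    (h : Nat.card (T ⧸ S.comap T.subtype) = 2) :
    ∃ w ∈ T, w ∉ S ∧ (2 : ℤ) • w ∈ S := by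
  have : Nontrivial (T ⧸ S.comap T.subtype) := by
    have : Finite (T ⧸ S.comap T.subtype) := Nat.finite_of_card_ne_zero (by omega)
    exact Finite.one_lt_card_iff_nontrivial.mp (by omega)
  obtain ⟨q, hq⟩ := exists_ne (0 : T ⧸ S.comap T.subtype)
  obtain ⟨w, rfl⟩ := Submodule.Quotient.mk_surjective _ q
  have h₂ : (2 : ℤ) • (Submodule.Quotient.mk w : T ⧸ S.comap T.subtype) = 0 := by
    have := card_nsmul_eq_zero' (x := (Submodule.Quotient.mk w : T ⧸ S.comap T.subtype))
    rw [h] at this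
    rw [← this, two_smul, two_smul]
  rw [← Submodule.Quotient.mk_smul, Submodule.Quotient.mk_eq_zero] at h₂
  rw [Ne, Submodule.Quotient.mk_eq_zero] at hq
  exact ⟨w, w.2, hq, h₂⟩

/-- for `d` odd (`L² ≡ 2 mod 4`) there is no even overlattice of
`Λ_{2d} = ℤL ⊕ E8(-2)` of index `2` in which `E8(-2)` is primitive. -/
theorem no_index_two_even_overlattice_of_odd_d (d : ℤ) (hd : 0 < d) (hodd : Odd d) :
    ¬ ∃ Λ' : Submodule ℤ Amb,
      Lambda ≤ Λ' ∧
      (∀ x ∈ Λ', ∀ y ∈ Λ', ∃ k : ℤ, bL d x y = k) ∧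
      (∀ x ∈ Λ', ∃ k : ℤ, bL d x x = 2 * k) ∧
      Nat.card (Λ' ⧸ Lambda.comap Λ'.subtype) = 2 ∧
      (∀ x ∈ Λ', ∀ n : ℤ, n ≠ 0 → n • x ∈ Esub → x ∈ Esub) := by
  rintro ⟨Λ', hle, -, heven, hcard, hprim⟩
  obtain ⟨w, hw, hwΛ, h2w⟩ := exists_mem_notMem_two_smul_mem hcard
  obtain ⟨h₁, h₂⟩ := h2w
  obtain ⟨a, ha⟩ := mem_Zsub_iff.mp h₁
  obtain ⟨v, hv⟩ := mem_ZV_iff.mp h₂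
  replace ha : (a : ℚ) = 2 * w.1 := by simpa using ha
  rcases Int.even_or_odd a with ⟨c, hc⟩ | hodd_a
  · -- Subtracting a multiple of `L` moves `w` into the saturation of `E8(-2)`.
    have hcw : w.1 = c := by
      rw [hc] at ha
      push_cast at ha
      linarith
    have hL : ((c : ℚ), (0 : Fin 8 → ℚ)) ∈ Lambda :=
      ⟨mem_Zsub_iff.mpr ⟨c, rfl⟩, ZV.zero_mem⟩
    have hE : w - ((c : ℚ), (0 : Fin 8 → ℚ)) ∈ Esub := by
      refine hprim _ (Λ'.sub_mem hw (hle hL)) 2 two_ne_zero ⟨?_, ?_⟩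
      · simp [hcw]
      · simpa using h₂
    refine hwΛ ⟨mem_Zsub_iff.mpr ⟨c, hcw.symm⟩, ?_⟩
    simpa using hE.2
  · obtain ⟨k, hk⟩ := heven w hw
    obtain ⟨m, hm⟩ := even_dotProduct_E8_mulVec v
    have hQ := dotProduct_E8Q_mulVec_intCast v
    have hv' : (fun i => (v i : ℚ)) = (2 : ℚ) • w.2 := by
      rw [hv]
      ext i
      simp
    rw [hv', hm, Matrix.mulVec_smul, smul_dotProduct, dotProduct_smul, smul_eq_mul,
      smul_eq_mul] at hQ
    have key : d * a * a - (m + m) = 4 * k := by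
      have : (d * a * a - (m + m) : ℚ) = 4 * k := by
        rw [bL] at hk
        push_cast at hQ
        rw [ha]
        linarith
      exact_mod_cast this
    obtain ⟨t, ht⟩ := (hodd.mul hodd_a).mul hodd_a
    omega
end

section
/- Let d be a positive even integer and let Λ_{2d} = ℤL ⊕ E8(−2), where L·L = 2d and L is orthogonal to E8(−2). Then any two even overlattices Λ̃₁, Λ̃₂ of Λ_{2d} with [Λ̃ᵢ : Λ_{2d}] = 2 in which both ℤL and E8(−2) are primitive sublattices are isometric; that is, the even overlattice Λ_{\widetilde{2d}} of index 2 with ℤL and E8(−2) primitive is unique up to isometry. -/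
open Matrix Finset

/-- The conditions on an even overlattice `Λ'` of `Λ_{2d}` of index `2` in which both
`ℤL` and `E8(-2)` are primitive sublattices. -/
def GoodOverlattice (d : ℤ) (Λ' : Submodule ℤ Amb) : Prop :=
  Lambda ≤ Λ' ∧
  (∀ x ∈ Λ', ∀ y ∈ Λ', ∃ k : ℤ, bL d x y = k) ∧
  (∀ x ∈ Λ', ∃ k : ℤ, bL d x x = 2 * k) ∧
  Nat.card (Λ' ⧸ Lambda.comap Λ'.subtype) = 2 ∧
  (∀ x ∈ Λ', ∀ n : ℤ, n ≠ 0 → n • x ∈ Lline → x ∈ Lline) ∧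
  (∀ x ∈ Λ', ∀ n : ℤ, n ≠ 0 → n • x ∈ Esub → x ∈ Esub)

lemma mem_Zsub {x : ℚ} : x ∈ Zsub ↔ ∃ k : ℤ, x = k := by
  simp [Zsub, Submodule.mem_span_singleton, eq_comm]

lemma mem_ZV {x : Fin 8 → ℚ} : x ∈ ZV ↔ ∃ z : Fin 8 → ℤ, x = fun i => (z i : ℚ) := by
  rw [ZV, Submodule.mem_span_range_iff_exists_fun]
  have key : ∀ z : Fin 8 → ℤ, ∑ i, z i • (Pi.single i 1 : Fin 8 → ℚ) = fun i => (z i : ℚ) := by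
    intro z
    ext j
    simp [Finset.sum_apply, Pi.single_apply]
  simp only [key, eq_comm]

lemma intCast_mem_ZV (z : Fin 8 → ℤ) : (fun i => (z i : ℚ)) ∈ ZV := mem_ZV.2 ⟨z, rfl⟩

/-- The `E8` form on `E8 ⊗ ℚ`, as a bilinear form. -/
noncomputable abbrev E8Bilin : LinearMap.BilinForm ℚ (Fin 8 → ℚ) := Matrix.toBilin' E8Q

lemma bL_eq (d : ℤ) (p q : Amb) :
    bL d p q = 2 * d * p.1 * q.1 - 2 * E8Bilin p.2 q.2 := by
  rw [bL, Matrix.toBilin'_apply']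
  ring

lemma E8Bilin_comm (x y : Fin 8 → ℚ) : E8Bilin x y = E8Bilin y x := by
  have h : E8Qᵀ = E8Q := by
    ext i j
    fin_cases i <;> fin_cases j <;> rfl
  rw [Matrix.toBilin'_apply', Matrix.toBilin'_apply', dotProduct_comm,
    ← Matrix.vecMul_transpose, h, Matrix.dotProduct_mulVec]

lemma E8Bilin_intCast (v w : Fin 8 → ℤ) :
    E8Bilin (fun i => (v i : ℚ)) (fun i => (w i : ℚ)) =
      ((v ⬝ᵥ (CartanMatrix.E₈ *ᵥ w) : ℤ) : ℚ) := by
  rw [Matrix.toBilin'_apply']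
  simp [E8Q, dotProduct, Matrix.mulVec]

lemma exists_E8Bilin_eq_intCast {x y : Fin 8 → ℚ} (hx : x ∈ ZV) (hy : y ∈ ZV) :
    ∃ k : ℤ, E8Bilin x y = k := by
  obtain ⟨v, rfl⟩ := mem_ZV.1 hx
  obtain ⟨w, rfl⟩ := mem_ZV.1 hy
  exact ⟨_, E8Bilin_intCast v w⟩

/-- The isometry group of the lattice `E8`, acting on `E8 ⊗ ℚ`. -/
def E8Isometries : Subgroup ((Fin 8 → ℚ) ≃ₗ[ℚ] (Fin 8 → ℚ)) where
  carrier := {g | (∀ x y, E8Bilin (g x) (g y) = E8Bilin x y) ∧ ∀ x, g x ∈ ZV ↔ x ∈ ZV}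
  one_mem' := by simp
  mul_mem' := by
    rintro g h ⟨hg, hg'⟩ ⟨hh, hh'⟩
    exact ⟨fun x y => by simp only [LinearEquiv.mul_apply, hg, hh],
      fun x => by simp only [LinearEquiv.mul_apply, hg', hh']⟩
  inv_mem' := by
    rintro g ⟨hg, hg'⟩
    have key : ∀ x, g (g⁻¹ x) = x := g.apply_symm_apply
    exact ⟨fun x y => by rw [← hg, key, key], fun x => by rw [← hg', key]⟩

/-- Equivalence of integral vectors under the image of the isometry group of `E8` in the
automorphism group of `E8 / 2 E8`. -/
def E8ModTwoEquiv (v w : Fin 8 → ℤ) : Prop :=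
  ∃ g ∈ E8Isometries, (2⁻¹ : ℚ) • (g (fun i => (v i : ℚ)) - fun i => (w i : ℚ)) ∈ ZV

namespace E8ModTwoEquiv

lemma of_modEq {v w : Fin 8 → ℤ} (h : ∀ i, v i ≡ w i [ZMOD 2]) : E8ModTwoEquiv v w := by
  refine ⟨1, one_mem _, ?_⟩
  choose z hz using fun i => (h i).symm.dvd
  convert intCast_mem_ZV z using 1
  ext i
  have := congrArg (Int.cast : ℤ → ℚ) (hz i)
  push_cast at this
  simp [this]

lemma symm {v w : Fin 8 → ℤ} (h : E8ModTwoEquiv v w) : E8ModTwoEquiv w v := by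
  obtain ⟨g, hg, h⟩ := h
  refine ⟨g⁻¹, inv_mem hg, ?_⟩
  rw [← neg_mem_iff, ← hg.2]
  convert h using 1
  have key : ∀ x, g (g⁻¹ x) = x := g.apply_symm_apply
  rw [map_neg, map_smul, map_sub, key, ← smul_neg, neg_sub]

lemma trans {u v w : Fin 8 → ℤ} (h : E8ModTwoEquiv u v) (h' : E8ModTwoEquiv v w) :
    E8ModTwoEquiv u w := by
  obtain ⟨g, hg, h⟩ := h
  obtain ⟨g', hg', h'⟩ := h'
  refine ⟨g' * g, mul_mem hg' hg, ?_⟩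
  rw [← hg'.2] at h
  convert add_mem h h' using 1
  rw [map_smul, map_sub, ← smul_add, sub_add_sub_cancel, LinearEquiv.mul_apply]

/-- Equivalent vectors have the same norm modulo `4`. -/
lemma norm_modEq {v w : Fin 8 → ℤ} (h : E8ModTwoEquiv v w) :
    v ⬝ᵥ (CartanMatrix.E₈ *ᵥ v) ≡ w ⬝ᵥ (CartanMatrix.E₈ *ᵥ w) [ZMOD 4] := by
  obtain ⟨g, hg, h⟩ := h
  obtain ⟨k, hk⟩ := exists_E8Bilin_eq_intCast h (intCast_mem_ZV w)
  obtain ⟨l, hl⟩ := exists_E8Bilin_eq_intCast h h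
  refine (Int.modEq_iff_dvd.2 ⟨k + l, ?_⟩).symm
  have hv := hg.1 (fun i => (v i : ℚ)) (fun i => (v i : ℚ))
  rw [E8Bilin_intCast] at hv
  have hw := E8Bilin_intCast w w
  have hc := E8Bilin_comm (g fun i => (v i : ℚ)) (fun i => (w i : ℚ))
  simp only [map_smul, map_sub, LinearMap.smul_apply, LinearMap.sub_apply, smul_eq_mul] at hk hl
  generalize v ⬝ᵥ (CartanMatrix.E₈ *ᵥ v) = a at *
  generalize w ⬝ᵥ (CartanMatrix.E₈ *ᵥ w) = b at *
  have : (a - b : ℚ) = 4 * (k + l) := by linarith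
  exact_mod_cast this

end E8ModTwoEquiv

/-- The simple reflections of `E8` are isometries. -/
lemma exists_simple_reflection (i : Fin 8) :
    ∃ g ∈ E8Isometries, ∀ v : Fin 8 → ℤ, g (fun j => (v j : ℚ)) =
      fun j => ((v - (CartanMatrix.E₈ *ᵥ v) i • Pi.single i 1 : Fin 8 → ℤ) j : ℚ) := by
  have hi : E8Bilin (Pi.single i 1) (Pi.single i 1) = 2 := by
    rw [Matrix.toBilin'_single, E8Q, Matrix.map_apply]
    revert i
    decide
  have he : (Pi.single i 1 : Fin 8 → ℚ) ∈ ZV := Submodule.subset_span ⟨i, rfl⟩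
  have happ : ∀ v : Fin 8 → ℤ,
      Module.reflection hi (fun j => (v j : ℚ)) =
        fun j => ((v - (CartanMatrix.E₈ *ᵥ v) i • Pi.single i 1 : Fin 8 → ℤ) j : ℚ) := by
    intro v
    rw [Module.reflection_apply, Matrix.toBilin'_apply', single_one_dotProduct]
    ext j
    simp [E8Q, Matrix.mulVec, dotProduct, Pi.single_apply]
  have hZ : ∀ x ∈ ZV, Module.reflection hi x ∈ ZV := by
    intro x hx
    obtain ⟨v, rfl⟩ := mem_ZV.1 hx
    rw [happ]
    exact intCast_mem_ZV _
  refine ⟨Module.reflection hi, ⟨fun x y => ?_, fun x => ⟨fun h => ?_, hZ x⟩⟩, happ⟩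
  · simp only [Module.reflection_apply, map_sub, map_smul, LinearMap.sub_apply,
      LinearMap.smul_apply, smul_eq_mul, hi, E8Bilin_comm x (Pi.single i 1)]
    ring
  · rw [← Module.involutive_reflection hi x]
    exact hZ _ h

/-- The vector in `{0, 1}⁸` whose coordinates are the binary digits of `n`. -/
def bitVector (n : ℕ) : Fin 8 → ℤ := fun i => (n.testBit i).toNat

/-- The action of the `i`-th simple reflection on `E8 / 2 E8`, in terms of binary digits. -/
def bitReflection (i : Fin 8) (n : ℕ) : ℕ :=
  if (CartanMatrix.E₈ *ᵥ bitVector n) i % 2 = 0 then n else n ^^^ 2 ^ (i : ℕ)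

lemma E8ModTwoEquiv.bitReflection (i : Fin 8) (n : ℕ) :
    E8ModTwoEquiv (bitVector n) (bitVector (bitReflection i n)) := by
  obtain ⟨g, hg, hgv⟩ := exists_simple_reflection i
  have key : E8ModTwoEquiv (bitVector n)
      (bitVector n - (CartanMatrix.E₈ *ᵥ bitVector n) i • Pi.single i 1) :=
    ⟨g, hg, by rw [hgv, sub_self, smul_zero]; exact zero_mem _⟩
  refine key.trans (.of_modEq fun j => ?_)
  generalize hc : (CartanMatrix.E₈ *ᵥ bitVector n) i = c
  rw [_root_.bitReflection, hc]
  by_cases hij : i = j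
  · subst hij
    split_ifs with h
    · simp [Int.ModEq]
      omega
    · cases hb : n.testBit i <;> simp [bitVector, Int.ModEq, Nat.testBit_xor, hb] <;> omega
  · have hval : (i : ℕ) ≠ j := fun h => hij (Fin.ext h)
    split_ifs <;>
    simp [bitVector, Ne.symm hij, Nat.testBit_xor, Nat.testBit_two_pow_of_ne hval]

/-- One step of a reduction of `E8 / 2 E8` to orbit representatives: the `n`-th hexadecimal digit
of the constant is the index of the simple reflection to be applied to `n`. -/
def bitReduce (n : ℕ) : ℕ :=
  bitReflection (Fin.ofNat 8
    (0x7777777777777777777777777777777777777777777776777777777777777777555555555555545511333212444443446666666666666566666666666666666666666666666666666666666666666666444444443320273355555555555555555555555555555455113332124444434444444444332025331133321220200300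
      / 16 ^ n)) n

lemma bitReduce_iterate (n : Fin 256) (hn : n ≠ 0) :
    bitReduce^[28] n = 1 ∨ bitReduce^[28] n = 3 := by
  revert n
  decide +kernel

lemma E8ModTwoEquiv.bitReduce_iterate (n k : ℕ) :
    E8ModTwoEquiv (bitVector n) (bitVector (bitReduce^[k] n)) := by
  induction k with
  | zero => exact .of_modEq fun _ => rfl
  | succ k ih =>
    rw [Function.iterate_succ_apply']
    exact ih.trans (.bitReflection _ _)

/-- There are at most two orbits of isometries on the nonzero vectors of `E8 / 2 E8`. -/
lemma E8ModTwoEquiv.one_or_three {v : Fin 8 → ℤ} (hv : ∃ i, v i % 2 ≠ 0) :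
    E8ModTwoEquiv v (bitVector 1) ∨ E8ModTwoEquiv v (bitVector 3) := by
  set n := Nat.ofBits fun i => decide (v i % 2 = 1)
  have hn : E8ModTwoEquiv v (bitVector n) := by
    refine .of_modEq fun i => ?_
    rw [bitVector, Nat.testBit_ofBits_lt _ _ i.isLt]
    rcases Int.emod_two_eq_zero_or_one (v i) with h | h <;> simp [Int.ModEq, h]
  have hn0 : n ≠ 0 := by
    obtain ⟨i, hi⟩ := hv
    intro h0
    have := Nat.testBit_ofBits_lt (fun i => decide (v i % 2 = 1)) i i.isLt
    rw [show Nat.ofBits _ = 0 from h0] at this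
    simp at this
    omega
  have hlt : n < 256 := Nat.ofBits_lt_two_pow _
  have key := hn.trans (.bitReduce_iterate n 28)
  rcases _root_.bitReduce_iterate ⟨n, hlt⟩ (by simpa [Fin.ext_iff] using hn0) with h | h
  · exact .inl (h ▸ key)
  · exact .inr (h ▸ key)

/-- Isometries of `E8` act transitively on the nonzero vectors of `E8 / 2 E8` of given norm
modulo `4`. -/
lemma E8ModTwoEquiv.of_norm_modEq {v w : Fin 8 → ℤ} (hv : ∃ i, v i % 2 ≠ 0)
    (hw : ∃ i, w i % 2 ≠ 0)
    (h : v ⬝ᵥ (CartanMatrix.E₈ *ᵥ v) ≡ w ⬝ᵥ (CartanMatrix.E₈ *ᵥ w) [ZMOD 4]) :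
    E8ModTwoEquiv v w := by
  have h13 : ¬ bitVector 1 ⬝ᵥ (CartanMatrix.E₈ *ᵥ bitVector 1) ≡
      bitVector 3 ⬝ᵥ (CartanMatrix.E₈ *ᵥ bitVector 3) [ZMOD 4] := by
    decide +kernel
  rcases one_or_three hv with hv | hv <;> rcases one_or_three hw with hw | hw
  · exact hv.trans hw.symm
  · exact (h13 (hv.norm_modEq.symm.trans (h.trans hw.norm_modEq))).elim
  · exact (h13 (hw.norm_modEq.symm.trans (h.symm.trans hv.norm_modEq))).elim
  · exact hv.trans hw.symm

lemma mem_Lambda {x : Amb} : x ∈ Lambda ↔ x.1 ∈ Zsub ∧ x.2 ∈ ZV := Submodule.mem_prod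

/-- The vector `(L + v) / 2`. -/
def glueVector (v : Fin 8 → ℤ) : Amb := (2⁻¹, (2⁻¹ : ℚ) • fun i => (v i : ℚ))

lemma GoodOverlattice.exists_glueVector {d : ℤ} {Λ : Submodule ℤ Amb} (h : GoodOverlattice d Λ) :
    ∃ v : Fin 8 → ℤ, (∃ i, v i % 2 ≠ 0) ∧
      v ⬝ᵥ (CartanMatrix.E₈ *ᵥ v) ≡ d [ZMOD 4] ∧
      ∀ x, x ∈ Λ ↔ x ∈ Lambda ∨ x - glueVector v ∈ Lambda := by
  obtain ⟨hle, -, heven, hcard, hL, hE⟩ := h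
  have hindex : (Lambda.comap Λ.subtype).toAddSubgroup.index = 2 := hcard
  obtain ⟨⟨x, hx⟩, hx2⟩ := AddSubgroup.index_eq_two_iff.1 hindex
  simp only [Submodule.mem_toAddSubgroup, Submodule.mem_comap, Submodule.subtype_apply,
    Subtype.forall, Submodule.coe_add] at hx2
  have hxΛ : x ∉ Lambda := by simpa [Xor] using hx2 0 (zero_mem _)
  have h2x : x + x ∈ Lambda := by
    have := hx2 x hx
    unfold Xor at this
    tauto
  obtain ⟨ha, hu⟩ := mem_Lambda.1 h2x
  obtain ⟨a, ha⟩ := mem_Zsub.1 ha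
  obtain ⟨v, hv⟩ := mem_ZV.1 hu
  have ha : x.1 = a / 2 := by
    rw [Prod.fst_add] at ha
    linarith
  have hv : x.2 = (2⁻¹ : ℚ) • fun i => (v i : ℚ) := by
    rw [← hv]
    ext i
    simp
    ring
  have hfst : ∀ k : ℤ, ((k : ℚ), (0 : Fin 8 → ℚ)) ∈ Lambda := fun k =>
    mem_Lambda.2 ⟨mem_Zsub.2 ⟨k, rfl⟩, zero_mem _⟩
  have hsnd : ∀ z : Fin 8 → ℤ, ((0 : ℚ), fun i => (z i : ℚ)) ∈ Lambda := fun z =>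
    mem_Lambda.2 ⟨zero_mem _, intCast_mem_ZV z⟩
  have hodd : a % 2 = 1 := by
    by_contra hodd
    obtain ⟨b, rfl⟩ : ∃ b, a = 2 * b := ⟨a / 2, by omega⟩
    have := hE (x - ((b : ℚ), 0)) (sub_mem hx (hle (hfst b))) 2 two_ne_zero (by
      refine Submodule.mem_prod.2 ⟨?_, ?_⟩
      · simp [ha]
      · simpa [two_smul] using hu)
    refine hxΛ ?_
    rw [← sub_add_cancel x ((b : ℚ), 0)]
    exact add_mem (mem_Lambda.2 ⟨bot_le (a := Zsub) this.1, this.2⟩) (hfst b)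
  obtain ⟨b, rfl⟩ : ∃ b, a = 2 * b + 1 := ⟨a / 2, by omega⟩
  have hglue : x - ((b : ℚ), 0) = glueVector v := by
    refine Prod.ext ?_ ?_
    · simp [glueVector, ha]
      ring
    · simp [glueVector, hv]
  have hmem : glueVector v ∈ Λ := hglue ▸ sub_mem hx (hle (hfst b))
  refine ⟨v, ?_, ?_, fun y => ⟨fun hy => ?_, ?_⟩⟩
  · by_contra! hv2
    choose z hz using fun i => Int.dvd_of_emod_eq_zero (hv2 i)
    have hvz : (2⁻¹ : ℚ) • (fun i => (v i : ℚ)) = fun i => (z i : ℚ) := by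
      ext i
      simp [hz]
    have := (hL (glueVector v - (0, fun i => (z i : ℚ))) (sub_mem hmem (hle (hsnd z))) 2
      two_ne_zero (Submodule.mem_prod.2 ⟨mem_Zsub.2 ⟨1, by simp [glueVector]⟩,
        by simp [glueVector, hvz]⟩)).1
    obtain ⟨k, hk⟩ := mem_Zsub.1 this
    simp only [glueVector, Prod.fst_sub, sub_zero] at hk
    have : (1 : ℚ) = ((2 * k : ℤ) : ℚ) := by
      push_cast
      linarith
    have : 1 = 2 * k := by exact_mod_cast this
    omega
  · obtain ⟨k, hk⟩ := heven _ hmem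
    simp only [bL_eq, glueVector, map_smul, LinearMap.smul_apply, E8Bilin_intCast,
      smul_eq_mul] at hk
    refine Int.modEq_iff_dvd.2 ⟨k, ?_⟩
    generalize v ⬝ᵥ (CartanMatrix.E₈ *ᵥ v) = a at *
    have : (d - a : ℚ) = 4 * k := by linarith
    exact_mod_cast this
  · by_cases hyΛ : y ∈ Lambda
    · exact .inl hyΛ
    · refine .inr ?_
      have hyx : y + x ∈ Lambda := by
        have := hx2 y hy
        unfold Xor at this
        tauto
      have := add_mem (sub_mem hyx h2x) (hfst b)
      convert this using 1
      rw [← hglue]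
      abel
  · rintro (hy | hy)
    · exact hle hy
    · rw [← sub_add_cancel y (glueVector v)]
      exact add_mem (hle hy) hmem

/-- for `d` even, any two even overlattices of `Λ_{2d}` of index `2` in
which both `ℤL` and `E8(-2)` are primitive sublattices are isometric; i.e. the
overlattice `Λ_{\widetilde{2d}}` is unique up to isometry. -/
theorem index_two_even_overlattice_unique (d : ℤ) (hd : 0 < d) (he : Even d)
    (Λ₁ Λ₂ : Submodule ℤ Amb)
    (h₁ : GoodOverlattice d Λ₁) (h₂ : GoodOverlattice d Λ₂) :
    ∃ e : Λ₁ ≃ₗ[ℤ] Λ₂,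
      ∀ x y : Λ₁, bL d ((e x : Λ₂) : Amb) ((e y : Λ₂) : Amb) = bL d (x : Amb) (y : Amb) := by
  obtain ⟨v, hv, hvd, hΛ₁⟩ := h₁.exists_glueVector
  obtain ⟨w, hw, hwd, hΛ₂⟩ := h₂.exists_glueVector
  obtain ⟨g, hg, hgvw⟩ := E8ModTwoEquiv.of_norm_modEq hv hw (hvd.trans hwd.symm)
  let f : Amb ≃ₗ[ℤ] Amb := (LinearEquiv.refl ℤ ℚ).prodCongr (g.restrictScalars ℤ)
  have hf : ∀ x, f x = (x.1, g x.2) := fun _ => rfl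
  have hfLambda : ∀ x, f x ∈ Lambda ↔ x ∈ Lambda := fun x => by
    rw [mem_Lambda, mem_Lambda, hf, hg.2]
  have hglue : f (glueVector v) - glueVector w ∈ Lambda := by
    refine mem_Lambda.2 ⟨by simp [hf, glueVector], ?_⟩
    simpa [hf, glueVector, smul_sub] using hgvw
  have hfΛ : ∀ x, f x ∈ Λ₂ ↔ x ∈ Λ₁ := fun x => by
    rw [hΛ₁, hΛ₂, hfLambda, ← hfLambda (x - glueVector v), map_sub,
      ← sub_add_sub_cancel (f x) (f (glueVector v)), add_mem_cancel_right hglue]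
  refine ⟨f.ofSubmodules Λ₁ Λ₂ ?_, fun x y => ?_⟩
  · ext x
    rw [Submodule.mem_map_equiv, ← hfΛ, f.apply_symm_apply]
  · simp only [LinearEquiv.ofSubmodules_apply, bL_eq, hf, hg.1]
end
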